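/- arXiv:0810.1577 — 2 statements merged into one kernel-verified Lean document; each statement's English description precedes it below -/
import Mathlib

section
/- (Lemma 2.3.) Under Assumption A, suppose (x₀,ξ₀) is forward nontrapping with respect to k with ξ-component of S₊(x₀,ξ₀) nonzero, and let Ω be a sufficiently small neighborhood of (x₀,ξ₀) (as in the escape estimate). Then for every σ with 0 < σ < π and every (x,ξ) ∈ Ω, lim_{λ→∞} exp(−σλ H_{p₀^λ}) ∘ exp(σλ H_{p^λ})(x,ξ) = S₊(x,ξ). -/
open Real Filter
open scoped BigOperators Topology

noncomputable section

/-- Euclidean configuration space `ℝⁿ`. -/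
abbrev En (n : ℕ) := EuclideanSpace ℝ (Fin n)

/-- Partial derivative `∂f/∂x_j` of a function on `ℝⁿ`. -/
noncomputable def pd {n : ℕ} (f : En n → ℝ) (j : Fin n) (x : En n) : ℝ :=
  fderiv ℝ f x (EuclideanSpace.single j 1)

/-- Japanese bracket `⟨x⟩ = (1+|x|²)^{1/2}` on `ℝⁿ`. -/
noncomputable def jb {n : ℕ} (x : En n) : ℝ := Real.sqrt (1 + ‖x‖ ^ 2)

/-- Japanese bracket `⟨t⟩` on `ℝ`. -/
noncomputable def jbR (t : ℝ) : ℝ := Real.sqrt (1 + t ^ 2)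

/-- Kronecker delta. -/
def kdelta {n : ℕ} (j k : Fin n) : ℝ := if j = k then 1 else 0

/-- Assumption A: smooth symmetric positive-definite coefficients `a_{jk}` which are a
short-range perturbation of `δ_{jk}`, and a potential `V = O(⟨x⟩^{2-μ})`, with symbol-type
bounds on all derivatives. -/
structure AssumptionA (n : ℕ) (a : Fin n → Fin n → En n → ℝ) (V : En n → ℝ) (μ : ℝ) : Prop where
  n_pos : 0 < n
  one_lt_mu : 1 < μ
  smooth_a : ∀ j k, ContDiff ℝ (⊤ : ℕ∞) (a j k)
  smooth_V : ContDiff ℝ (⊤ : ℕ∞) V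
  symm : ∀ j k x, a j k x = a k j x
  posdef : ∀ x (ξ : En n), ξ ≠ 0 → 0 < ∑ j, ∑ k, a j k x * ξ j * ξ k
  decay_a : ∀ (m : ℕ) (j k : Fin n), ∃ C > 0, ∀ x,
      ‖iteratedFDeriv ℝ m (fun y => a j k y - kdelta j k) x‖ ≤ C * jb x ^ (-μ - (m : ℝ))
  decay_V : ∀ (m : ℕ), ∃ C > 0, ∀ x,
      ‖iteratedFDeriv ℝ m V x‖ ≤ C * jb x ^ (2 - μ - (m : ℝ))

/-- Kinetic energy symbol `k(x,ξ) = ½ Σ a_{jk}(x) ξ_j ξ_k`. -/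
noncomputable def ksym {n : ℕ} (a : Fin n → Fin n → En n → ℝ) (x ξ : En n) : ℝ :=
  (1 / 2) * ∑ j, ∑ k, a j k x * ξ j * ξ k

/-- Full symbol `p(x,ξ) = k(x,ξ) + ½|x|² + V(x)`. -/
noncomputable def psym {n : ℕ} (a : Fin n → Fin n → En n → ℝ) (V : En n → ℝ) (x ξ : En n) : ℝ :=
  ksym a x ξ + ‖x‖ ^ 2 / 2 + V x

/-- Scaled symbol `p^λ(x,ξ) = k(x,ξ) + |x|²/(2λ²) + V(x)/λ²`. -/
noncomputable def plam {n : ℕ} (a : Fin n → Fin n → En n → ℝ) (V : En n → ℝ) (lam : ℝ)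
    (x ξ : En n) : ℝ :=
  ksym a x ξ + ‖x‖ ^ 2 / (2 * lam ^ 2) + V x / lam ^ 2

/-- `(y,η)` is a (global) solution of the Hamilton equations of `k(x,ξ)=½Σa_{jk}(x)ξ_jξ_k`. -/
def IsFlowK {n : ℕ} (a : Fin n → Fin n → En n → ℝ) (y η : ℝ → En n) : Prop :=
  (∀ t (j : Fin n), HasDerivAt (fun s => y s j) (∑ i, a j i (y t) * η t i) t) ∧
  (∀ t (j : Fin n), HasDerivAt (fun s => η s j)
      (-((1 / 2) * ∑ i, ∑ l, pd (a i l) j (y t) * η t i * η t l)) t)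

/-- `(y,η)` is a (global) solution of the Hamilton equations of `p(x,ξ)`. -/
def IsFlowP {n : ℕ} (a : Fin n → Fin n → En n → ℝ) (V : En n → ℝ) (y η : ℝ → En n) : Prop :=
  (∀ t (j : Fin n), HasDerivAt (fun s => y s j) (∑ i, a j i (y t) * η t i) t) ∧
  (∀ t (j : Fin n), HasDerivAt (fun s => η s j)
      (-((1 / 2) * ∑ i, ∑ l, pd (a i l) j (y t) * η t i * η t l + y t j + pd V j (y t))) t)

/-- `(y,η)` is a (global) solution of the Hamilton equations of `p^λ(x,ξ)`. -/
def IsFlowPlam {n : ℕ} (a : Fin n → Fin n → En n → ℝ) (V : En n → ℝ) (lam : ℝ)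
    (y η : ℝ → En n) : Prop :=
  (∀ t (j : Fin n), HasDerivAt (fun s => y s j) (∑ i, a j i (y t) * η t i) t) ∧
  (∀ t (j : Fin n), HasDerivAt (fun s => η s j)
      (-((1 / 2) * ∑ i, ∑ l, pd (a i l) j (y t) * η t i * η t l
          + y t j / lam ^ 2 + pd V j (y t) / lam ^ 2)) t)

/-- First (position) component of `exp(-tH_{p₀^λ})` applied to `(y t, η t)`:
`z^λ(t) = cos(t/λ) y^λ(t) − λ sin(t/λ) η^λ(t)`. -/
noncomputable def zlam {n : ℕ} (lam : ℝ) (y η : ℝ → En n) (t : ℝ) : En n :=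
  Real.cos (t / lam) • y t - (lam * Real.sin (t / lam)) • η t

/-- Second (momentum) component: `ζ^λ(t) = λ⁻¹ sin(t/λ) y^λ(t) + cos(t/λ) η^λ(t)`. -/
noncomputable def zetalam {n : ℕ} (lam : ℝ) (y η : ℝ → En n) (t : ℝ) : En n :=
  (lam⁻¹ * Real.sin (t / lam)) • y t + Real.cos (t / lam) • η t

end

/-- A strict bound that is self-improving on initial segments holds throughout. -/
theorem lt_of_self_improving_bound {f : ℝ → ℝ} {a b ε : ℝ} (hf : ContinuousOn f (Set.Icc a b))
    (ha : f a < ε)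
    (h : ∀ t ∈ Set.Icc a b, (∀ s ∈ Set.Icc a t, f s ≤ ε) → f t < ε) :
    ∀ t ∈ Set.Icc a b, f t < ε := by
  by_contra! hcon
  obtain ⟨t, ht, hft⟩ := hcon
  have hcl : IsClosed (Set.Icc a b ∩ f ⁻¹' Set.Ici ε) :=
    hf.preimage_isClosed_of_isClosed isClosed_Icc isClosed_Ici
  have hcomp : IsCompact (Set.Icc a b ∩ f ⁻¹' Set.Ici ε) :=
    isCompact_Icc.of_isClosed_subset hcl Set.inter_subset_left
  obtain ⟨t₀, ⟨ht₀, hft₀⟩, hleast⟩ := hcomp.exists_isLeast ⟨t, ht, hft⟩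
  have hmin : ∀ s ∈ Set.Icc a b, ε ≤ f s → t₀ ≤ s := fun s hs hfs => hleast ⟨hs, hfs⟩
  obtain ⟨s, hs, hfs⟩ := intermediate_value_Icc ht₀.1
    (hf.mono (Set.Icc_subset_Icc_right ht₀.2)) ⟨ha.le, hft₀⟩
  have hst : s = t₀ := le_antisymm hs.2 (hmin s ⟨hs.1, hs.2.trans ht₀.2⟩ hfs.ge)
  refine absurd (h t₀ ht₀ fun r hr => ?_) (not_lt.2 hft₀)
  by_contra! hlt
  have := hmin r ⟨hr.1, hr.2.trans ht₀.2⟩ hlt.le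
  rw [le_antisymm hr.2 this, ← hst, hfs] at hlt
  exact lt_irrefl _ hlt

/-- Continuous dependence on a vanishing perturbation of the vector field, without a priori bounds
on the perturbed trajectories. -/
theorem tendsto_perturbed_trajectory {ι E : Type*} [NormedAddCommGroup E] [NormedSpace ℝ E]
    [FiniteDimensional ℝ E] {l : Filter ι} {F G : E → E} (hF : ContDiff ℝ 1 F)
    (hG : Continuous G) {u : ℝ → E} (hu : ∀ t, HasDerivAt u (F (u t)) t) {w : ι → ℝ → E}
    {c : ι → ℝ} (hc : Tendsto c l (𝓝 0))
    (hw : ∀ᶠ i in l, (∀ t, HasDerivAt (w i) (F (w i t) + c i • G (w i t)) t) ∧ w i 0 = u 0)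
    {T : ℝ} (hT : 0 ≤ T) : Tendsto (fun i => w i T) l (𝓝 (u T)) := by
  have hucont : Continuous u := continuous_iff_continuousAt.2 fun t => (hu t).continuousAt
  obtain ⟨R, hR⟩ := (isCompact_Icc (a := (0 : ℝ)) (b := T)).exists_bound_of_continuousOn
    hucont.continuousOn
  set S : Set E := Metric.closedBall 0 (R + 1) with hS
  have hScomp : IsCompact S := isCompact_closedBall 0 (R + 1)
  obtain ⟨K₀, hK₀⟩ := LocallyLipschitzOn.exists_lipschitzOnWith_of_compact hScomp
    (hF.locallyLipschitz.locallyLipschitzOn)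
  obtain ⟨B, hB⟩ := hScomp.exists_bound_of_continuousOn hG.continuousOn
  set K := K₀ + 1
  have hK : LipschitzOnWith K F S := hK₀.weaken (by simp [K])
  have hK1 : (1 : ℝ) ≤ (K : ℝ) := by simp [K]
  rw [Metric.tendsto_nhds]
  intro ε' hε'
  set ε := min ε' 1
  have hε : 0 < ε := lt_min hε' one_pos
  have hsmall : Tendsto (fun i => |c i| * B * Real.exp (K * T)) l (𝓝 0) := by
    simpa using (hc.abs.mul_const B).mul_const (Real.exp (K * T))
  filter_upwards [hw, hsmall.eventually (gt_mem_nhds hε)] with i ⟨hwi, hwi0⟩ hi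
  have hwcont : Continuous (w i) := continuous_iff_continuousAt.2 fun t => (hwi t).continuousAt
  refine lt_of_lt_of_le (lt_of_self_improving_bound (f := fun t => dist (w i t) (u t)) (a := 0)
    (b := T) (hwcont.dist hucont).continuousOn (by simpa only [hwi0, dist_self] using hε) ?_
    T ⟨hT, le_rfl⟩)
    (min_le_left ε' 1)
  intro t ht hle
  have hmemu : ∀ s ∈ Set.Ico 0 t, u s ∈ S := fun s hs => by
    have := hR s ⟨hs.1, hs.2.le.trans ht.2⟩
    simp only [hS, mem_closedBall_zero_iff]; linarith
  have hmemw : ∀ s ∈ Set.Ico 0 t, w i s ∈ S := fun s hs => by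
    have h1 := hR s ⟨hs.1, hs.2.le.trans ht.2⟩
    have h2 : ‖w i s - u s‖ ≤ 1 := by
      rw [← dist_eq_norm]; exact (hle s ⟨hs.1, hs.2.le⟩).trans (min_le_right _ _)
    have h3 := norm_le_norm_add_norm_sub' (w i s) (u s)
    simp only [hS, mem_closedBall_zero_iff]; linarith
  have hgr := dist_le_of_approx_trajectories_ODE_of_mem (v := fun _ => F) (s := fun _ => S)
    (K := K) (a := 0) (b := t) (δ := 0) (εf := |c i| * B) (εg := 0)
    (fun _ _ => hK) hwcont.continuousOn (fun s _ => (hwi s).hasDerivWithinAt)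
    (fun s hs => by
      rw [dist_eq_norm, add_sub_cancel_left, norm_smul, Real.norm_eq_abs]
      exact mul_le_mul_of_nonneg_left (hB _ (hmemw s hs)) (abs_nonneg _))
    hmemw hucont.continuousOn (fun s _ => (hu s).hasDerivWithinAt) (fun s _ => by simp)
    hmemu (by simp [hwi0]) t ⟨ht.1, le_rfl⟩
  have hB0 : 0 ≤ B := by
    rcases ht.1.eq_or_lt with h0 | h0
    · refine (norm_nonneg _).trans (hB (u 0) ?_)
      have := hR 0 ⟨le_rfl, hT⟩
      simp only [hS, mem_closedBall_zero_iff]; linarith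
    · exact (norm_nonneg _).trans (hB (u 0) (hmemu 0 ⟨le_rfl, h0⟩))
  refine lt_of_le_of_lt hgr (lt_of_le_of_lt ?_ hi)
  rw [gronwallBound_of_K_ne_0 (by positivity), sub_zero, add_zero]
  beta_reduce
  rw [zero_mul, zero_add]
  have hexp : Real.exp (K * t) - 1 ≤ Real.exp (K * T) := by
    have : Real.exp (K * t) ≤ Real.exp (K * T) :=
      Real.exp_le_exp.2 (mul_le_mul_of_nonneg_left ht.2 (by positivity))
    linarith
  have hdiv : |c i| * B / K ≤ |c i| * B := div_le_self (by positivity) hK1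
  have hexp0 : 0 ≤ Real.exp (K * t) - 1 := by
    have : (1 : ℝ) ≤ Real.exp (K * t) := Real.one_le_exp (mul_nonneg (by positivity) ht.1)
    linarith
  exact mul_le_mul hdiv hexp hexp0 (by positivity)

section PhaseSpace

variable {n : ℕ}

/-- The velocity `∂_ξ k` of the kinetic energy symbol at a point of phase space. -/
noncomputable def kineticVelocity (a : Fin n → Fin n → En n → ℝ) (p : En n × En n) : En n :=
  WithLp.toLp 2 fun j => ∑ i, a j i p.1 * p.2 i

/-- The position gradient `∂_x k` of the kinetic energy symbol at a point of phase space. -/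
noncomputable def kineticGradient (a : Fin n → Fin n → En n → ℝ) (p : En n × En n) : En n :=
  WithLp.toLp 2 fun j => (1 / 2) * ∑ i, ∑ l, pd (a i l) j p.1 * p.2 i * p.2 l

/-- The gradient of a function on `ℝⁿ`, assembled from its partial derivatives. -/
noncomputable def euclideanGradient (V : En n → ℝ) (x : En n) : En n :=
  WithLp.toLp 2 fun j => pd V j x

theorem hasDerivAt_euclidean {f : ℝ → En n} {f' : En n} {t : ℝ}
    (h : ∀ j, HasDerivAt (fun s => f s j) (f' j) t) : HasDerivAt f f' t := by
  have h1 : HasDerivAt (fun s => WithLp.ofLp (f s)) (WithLp.ofLp f') t := hasDerivAt_pi.2 h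
  exact (PiLp.hasFDerivAt_toLp (𝕜 := ℝ) 2 (WithLp.ofLp (f t))).comp_hasDerivAt t h1

theorem IsFlowK.hasDerivAt {a : Fin n → Fin n → En n → ℝ} {y η : ℝ → En n}
    (h : IsFlowK a y η) (t : ℝ) :
    HasDerivAt (fun s => (y s, η s))
      (kineticVelocity a (y t, η t), -kineticGradient a (y t, η t)) t :=
  HasDerivAt.prodMk (hasDerivAt_euclidean fun j => by simpa [kineticVelocity] using h.1 t j)
    (hasDerivAt_euclidean fun j => by simpa [kineticGradient] using h.2 t j)

theorem IsFlowPlam.hasDerivAt_fst {a : Fin n → Fin n → En n → ℝ} {V : En n → ℝ} {lam : ℝ}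
    {y η : ℝ → En n} (h : IsFlowPlam a V lam y η) (t : ℝ) :
    HasDerivAt y (kineticVelocity a (y t, η t)) t :=
  hasDerivAt_euclidean fun j => h.1 t j

theorem IsFlowPlam.hasDerivAt_snd {a : Fin n → Fin n → En n → ℝ} {V : En n → ℝ} {lam : ℝ}
    {y η : ℝ → En n} (h : IsFlowPlam a V lam y η) (t : ℝ) :
    HasDerivAt η (-(kineticGradient a (y t, η t)
      + (lam ^ 2)⁻¹ • (y t + euclideanGradient V (y t)))) t :=
  hasDerivAt_euclidean fun j => by
    convert h.2 t j using 1
    simp [kineticGradient, euclideanGradient, -neg_add_rev]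
    ring

theorem contDiff_pd {f : En n → ℝ} (hf : ContDiff ℝ (⊤ : ℕ∞) f) (j : Fin n) :
    ContDiff ℝ 1 (pd f j) := by
  have h1 : ContDiff ℝ 1 (fderiv ℝ f) := hf.fderiv_right (by norm_cast)
  exact h1.clm_apply contDiff_const

theorem AssumptionA.contDiff_kineticVelocity {a : Fin n → Fin n → En n → ℝ} {V : En n → ℝ}
    {μ : ℝ} (hA : AssumptionA n a V μ) : ContDiff ℝ 1 (kineticVelocity a) := by
  refine contDiff_euclidean.2 fun j => ?_
  change ContDiff ℝ 1 fun p : En n × En n => ∑ i, a j i p.1 * p.2 i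
  refine ContDiff.sum fun i _ => ContDiff.mul ?_ ?_
  · exact ((hA.smooth_a j i).of_le (by norm_cast)).comp contDiff_fst
  · exact contDiff_euclidean.1 contDiff_snd i

theorem AssumptionA.contDiff_kineticGradient {a : Fin n → Fin n → En n → ℝ} {V : En n → ℝ}
    {μ : ℝ} (hA : AssumptionA n a V μ) : ContDiff ℝ 1 (kineticGradient a) := by
  refine contDiff_euclidean.2 fun j => ?_
  change ContDiff ℝ 1 fun p : En n × En n =>
    (1 / 2 : ℝ) * ∑ i, ∑ l, pd (a i l) j p.1 * p.2 i * p.2 l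
  refine contDiff_const.mul (ContDiff.sum fun i _ => ContDiff.sum fun l _ =>
    ContDiff.mul (ContDiff.mul ?_ ?_) ?_)
  · exact (contDiff_pd (hA.smooth_a i l) j).comp contDiff_fst
  · exact contDiff_euclidean.1 contDiff_snd i
  · exact contDiff_euclidean.1 contDiff_snd l

theorem AssumptionA.continuous_euclideanGradient {a : Fin n → Fin n → En n → ℝ} {V : En n → ℝ}
    {μ : ℝ} (hA : AssumptionA n a V μ) : Continuous (euclideanGradient V) :=
  (contDiff_euclidean.2 fun j => contDiff_pd hA.smooth_V j).continuous

/-- The flows of `p^λ` converge to the flow of `k` at each fixed nonnegative time. -/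
theorem tendsto_flowPlam {a : Fin n → Fin n → En n → ℝ} {V : En n → ℝ} {μ : ℝ}
    (hA : AssumptionA n a V μ) {x ξ : En n} {ty tη : ℝ → En n} (hk : IsFlowK a ty tη)
    (hty0 : ty 0 = x) (htη0 : tη 0 = ξ) {Y H : ℝ → ℝ → En n}
    (hYH : ∀ lam : ℝ, 0 < lam →
      IsFlowPlam a V lam (Y lam) (H lam) ∧ Y lam 0 = x ∧ H lam 0 = ξ) {T : ℝ} (hT : 0 ≤ T) :
    Tendsto (fun lam => (Y lam T, H lam T)) atTop (𝓝 (ty T, tη T)) := by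
  have hc : Tendsto (fun lam : ℝ => (lam ^ 2)⁻¹) atTop (𝓝 0) :=
    (tendsto_pow_atTop two_ne_zero).inv_tendsto_atTop
  refine tendsto_perturbed_trajectory
    (F := fun p : En n × En n => (kineticVelocity a p, -kineticGradient a p))
    (G := fun p : En n × En n => (0, -(p.1 + euclideanGradient V p.1)))
    (u := fun t => (ty t, tη t)) (w := fun lam t => (Y lam t, H lam t))
    (hA.contDiff_kineticVelocity.prodMk hA.contDiff_kineticGradient.neg)
    (continuous_const.prodMk
      (continuous_fst.add (hA.continuous_euclideanGradient.comp continuous_fst)).neg)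
    hk.hasDerivAt hc ?_ hT
  filter_upwards [eventually_gt_atTop (0 : ℝ)] with lam hlam
  obtain ⟨h1, h2, h3⟩ := hYH lam hlam
  refine ⟨fun t => ?_, by simp [h2, h3, hty0, htη0]⟩
  refine ((h1.hasDerivAt_fst t).prodMk (h1.hasDerivAt_snd t)).congr_deriv ?_
  ext j <;> simp; try ring

theorem euclidean_norm_le_sum (x : En n) : ‖x‖ ≤ ∑ j, |x j| := by
  conv_lhs => rw [← (EuclideanSpace.basisFun (Fin n) ℝ).sum_repr x]
  refine (norm_sum_le _ _).trans (Finset.sum_le_sum fun j _ => ?_)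
  simp [norm_smul]

theorem abs_euclidean_apply_le (x : En n) (j : Fin n) : |x j| ≤ ‖x‖ :=
  PiLp.norm_apply_le x j

theorem jb_pos (x : En n) : 0 < jb x := Real.sqrt_pos.2 (by positivity)

theorem norm_le_jb (x : En n) : ‖x‖ ≤ jb x :=
  Real.le_sqrt_of_sq_le (by linarith)

theorem jb_rpow_le {x : En n} {r e : ℝ} (hr : 0 < r) (he : e ≤ 0) (hx : r ≤ ‖x‖) :
    jb x ^ e ≤ r ^ e :=
  Real.rpow_le_rpow_of_nonpos hr (hx.trans (norm_le_jb x)) he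

theorem abs_pd_le (f : En n → ℝ) (j : Fin n) (x : En n) :
    |pd f j x| ≤ ‖iteratedFDeriv ℝ 1 f x‖ := by
  rw [norm_iteratedFDeriv_one]
  simpa [pd] using (fderiv ℝ f x).le_opNorm (EuclideanSpace.single j 1)

theorem AssumptionA.norm_kineticVelocity_sub_le {a : Fin n → Fin n → En n → ℝ} {V : En n → ℝ}
    {μ : ℝ} (hA : AssumptionA n a V μ) :
    ∃ C ≥ 0, ∀ p : En n × En n, ‖kineticVelocity a p - p.2‖ ≤ C * jb p.1 ^ (-μ) * ‖p.2‖ := by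
  choose C hC hb using hA.decay_a 0
  refine ⟨∑ j, ∑ i, C j i, Finset.sum_nonneg fun j _ => Finset.sum_nonneg fun i _ => (hC j i).le,
    fun p => (euclidean_norm_le_sum _).trans ?_⟩
  rw [Finset.sum_mul, Finset.sum_mul]
  refine Finset.sum_le_sum fun j _ => ?_
  have hcoord : (kineticVelocity a p - p.2) j = ∑ i, (a j i p.1 - kdelta j i) * p.2 i := by
    simp [kineticVelocity, kdelta, sub_mul, Finset.sum_sub_distrib]
  rw [hcoord, Finset.sum_mul, Finset.sum_mul]
  refine (Finset.abs_sum_le_sum_abs _ _).trans (Finset.sum_le_sum fun i _ => ?_)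
  rw [abs_mul]
  have h1 := hb j i p.1
  rw [norm_iteratedFDeriv_zero, Real.norm_eq_abs, Nat.cast_zero, sub_zero] at h1
  exact mul_le_mul h1 (abs_euclidean_apply_le _ _) (abs_nonneg _) ((abs_nonneg _).trans h1)

theorem AssumptionA.norm_kineticGradient_le {a : Fin n → Fin n → En n → ℝ} {V : En n → ℝ}
    {μ : ℝ} (hA : AssumptionA n a V μ) :
    ∃ C ≥ 0, ∀ p : En n × En n, ‖kineticGradient a p‖ ≤ C * jb p.1 ^ (-μ - 1) * ‖p.2‖ ^ 2 := by
  choose C hC hb using hA.decay_a 1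
  refine ⟨∑ j : Fin n, ∑ i, ∑ l, C i l, Finset.sum_nonneg fun j _ => Finset.sum_nonneg fun i _ =>
    Finset.sum_nonneg fun l _ => (hC i l).le, fun p => (euclidean_norm_le_sum _).trans ?_⟩
  rw [Finset.sum_mul, Finset.sum_mul]
  refine Finset.sum_le_sum fun j _ => ?_
  have hhalf : |kineticGradient a p j| ≤ |∑ i, ∑ l, pd (a i l) j p.1 * p.2 i * p.2 l| := by
    simp only [kineticGradient, abs_mul]
    rw [abs_of_pos (by norm_num : (0 : ℝ) < 1 / 2)]
    linarith [abs_nonneg (∑ i, ∑ l, pd (a i l) j p.1 * p.2 i * p.2 l)]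
  refine hhalf.trans ((Finset.abs_sum_le_sum_abs _ _).trans ?_)
  rw [Finset.sum_mul, Finset.sum_mul]
  refine Finset.sum_le_sum fun i _ => (Finset.abs_sum_le_sum_abs _ _).trans ?_
  rw [Finset.sum_mul, Finset.sum_mul]
  refine Finset.sum_le_sum fun l _ => ?_
  have h1 : |pd (a i l) j p.1| ≤ C i l * jb p.1 ^ (-μ - 1) := by
    have hshift : pd (a i l) j p.1 = pd (fun y => a i l y - kdelta i l) j p.1 := by
      rw [pd, pd, fderiv_sub_const]
    rw [hshift]
    simpa using (abs_pd_le _ _ _).trans (hb i l p.1)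
  rw [abs_mul, abs_mul, pow_two, ← mul_assoc]
  have h2 := abs_euclidean_apply_le p.2
  have h0 := (abs_nonneg _).trans h1
  exact mul_le_mul (mul_le_mul h1 (h2 i) (abs_nonneg _) h0) (h2 l) (abs_nonneg _)
    (mul_nonneg h0 (norm_nonneg _))

theorem AssumptionA.norm_euclideanGradient_le {a : Fin n → Fin n → En n → ℝ} {V : En n → ℝ}
    {μ : ℝ} (hA : AssumptionA n a V μ) :
    ∃ C ≥ 0, ∀ x : En n, ‖euclideanGradient V x‖ ≤ C * jb x ^ (1 - μ) := by
  obtain ⟨C, hC, hb⟩ := hA.decay_V 1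
  refine ⟨∑ _j : Fin n, C, Finset.sum_nonneg fun j _ => hC.le,
    fun x => (euclidean_norm_le_sum _).trans ?_⟩
  rw [Finset.sum_mul]
  refine Finset.sum_le_sum fun j _ => (abs_pd_le V j x).trans ((hb x).trans_eq ?_)
  congr 2
  push_cast
  ring

/-- Along trajectories leaving every ball linearly with bounded momentum, the deviation from the
harmonic flow is driven by a field of size `t ^ (-μ)`, uniformly in `λ`. -/
theorem AssumptionA.exists_drift_bound {a : Fin n → Fin n → En n → ℝ} {V : En n → ℝ} {μ : ℝ}
    (hA : AssumptionA n a V μ) {r L σ : ℝ} (hr : 0 < r) (hL : 0 ≤ L) (hσ : 0 < σ) :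
    ∃ D ≥ 0, ∀ (lam t α β : ℝ) (p : En n × En n), 1 ≤ t → |α| ≤ 1 → |β| ≤ t →
      |β| * (lam ^ 2)⁻¹ ≤ σ / t → r * t ≤ ‖p.1‖ → ‖p.2‖ ≤ L →
      ‖α • (kineticVelocity a p - p.2)
        + β • (kineticGradient a p + (lam ^ 2)⁻¹ • euclideanGradient V p.1)‖ ≤ D * t ^ (-μ) := by
  obtain ⟨C₁, hC₁, h₁⟩ := hA.norm_kineticVelocity_sub_le
  obtain ⟨C₂, hC₂, h₂⟩ := hA.norm_kineticGradient_le
  obtain ⟨C₃, hC₃, h₃⟩ := hA.norm_euclideanGradient_le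
  have hμ := hA.one_lt_mu
  refine ⟨C₁ * r ^ (-μ) * L + C₂ * r ^ (-μ - 1) * L ^ 2 + σ * (C₃ * r ^ (1 - μ)), by positivity,
    fun lam t α β p ht hα hβ hβlam hp1 hp2 => ?_⟩
  have ht0 : 0 < t := by linarith
  have hrt : 0 < r * t := by positivity
  have hA1 : ‖kineticVelocity a p - p.2‖ ≤ C₁ * (r ^ (-μ) * t ^ (-μ)) * L := by
    rw [← Real.mul_rpow hr.le ht0.le]
    refine (h₁ p).trans (mul_le_mul ?_ hp2 (norm_nonneg _) (by positivity))
    exact mul_le_mul_of_nonneg_left (jb_rpow_le hrt (by linarith) hp1) hC₁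
  have hA2 : ‖kineticGradient a p‖ ≤ C₂ * (r ^ (-μ - 1) * t ^ (-μ - 1)) * L ^ 2 := by
    rw [← Real.mul_rpow hr.le ht0.le]
    refine (h₂ p).trans (mul_le_mul ?_ (pow_le_pow_left₀ (norm_nonneg _) hp2 2) (by positivity)
      (by positivity))
    exact mul_le_mul_of_nonneg_left (jb_rpow_le hrt (by linarith) hp1) hC₂
  have hA3 : ‖euclideanGradient V p.1‖ ≤ C₃ * (r ^ (1 - μ) * t ^ (1 - μ)) := by
    rw [← Real.mul_rpow hr.le ht0.le]
    exact (h₃ p.1).trans (mul_le_mul_of_nonneg_left (jb_rpow_le hrt (by linarith) hp1) hC₃)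
  have e2 : t ^ (-μ - 1) = t ^ (-μ) / t := Real.rpow_sub_one ht0.ne' _
  have e3 : t ^ (1 - μ) = t ^ (-μ) * t := by
    rw [sub_eq_add_neg, add_comm, Real.rpow_add_one ht0.ne']
  calc ‖α • (kineticVelocity a p - p.2)
        + β • (kineticGradient a p + (lam ^ 2)⁻¹ • euclideanGradient V p.1)‖
      ≤ |α| * ‖kineticVelocity a p - p.2‖ + (|β| * ‖kineticGradient a p‖
        + |β| * (lam ^ 2)⁻¹ * ‖euclideanGradient V p.1‖) := by
        refine (norm_add_le _ _).trans (add_le_add (norm_smul_le _ _) ?_)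
        rw [smul_add, smul_smul]
        refine (norm_add_le _ _).trans (add_le_add (norm_smul_le _ _) ?_)
        rw [norm_smul, Real.norm_eq_abs, abs_mul, abs_of_nonneg (by positivity : 0 ≤ (lam ^ 2)⁻¹)]
    _ ≤ 1 * (C₁ * (r ^ (-μ) * t ^ (-μ)) * L)
        + (t * (C₂ * (r ^ (-μ - 1) * t ^ (-μ - 1)) * L ^ 2)
        + σ / t * (C₃ * (r ^ (1 - μ) * t ^ (1 - μ)))) := by gcongr
    _ = _ := by
        rw [e2, e3]
        field_simp
        ring

theorem IsFlowPlam.hasDerivAt_zlam {a : Fin n → Fin n → En n → ℝ} {V : En n → ℝ} {lam : ℝ}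
    {y η : ℝ → En n} (h : IsFlowPlam a V lam y η) (hlam : lam ≠ 0) (t : ℝ) :
    HasDerivAt (zlam lam y η)
      (Real.cos (t / lam) • (kineticVelocity a (y t, η t) - η t)
        + (lam * Real.sin (t / lam)) • (kineticGradient a (y t, η t)
          + (lam ^ 2)⁻¹ • euclideanGradient V (y t))) t := by
  have hd : HasDerivAt (fun s : ℝ => s / lam) (1 / lam) t := (hasDerivAt_id t).div_const lam
  refine ((hd.cos.smul (h.hasDerivAt_fst t)).sub
    ((hd.sin.const_mul lam).smul (h.hasDerivAt_snd t))).congr_deriv ?_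
  match_scalars <;> field_simp
  ring

theorem IsFlowPlam.hasDerivAt_zetalam {a : Fin n → Fin n → En n → ℝ} {V : En n → ℝ} {lam : ℝ}
    {y η : ℝ → En n} (h : IsFlowPlam a V lam y η) (hlam : lam ≠ 0) (t : ℝ) :
    HasDerivAt (zetalam lam y η)
      ((lam⁻¹ * Real.sin (t / lam)) • (kineticVelocity a (y t, η t) - η t)
        + (-Real.cos (t / lam)) • (kineticGradient a (y t, η t)
          + (lam ^ 2)⁻¹ • euclideanGradient V (y t))) t := by
  have hd : HasDerivAt (fun s : ℝ => s / lam) (1 / lam) t := (hasDerivAt_id t).div_const lam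
  refine (((hd.sin.const_mul lam⁻¹).smul (h.hasDerivAt_fst t)).add
    (hd.cos.smul (h.hasDerivAt_snd t))).congr_deriv ?_
  match_scalars <;> field_simp
  ring

theorem cos_smul_zlam_add (lam : ℝ) (hlam : lam ≠ 0) (y η : ℝ → En n) (t : ℝ) :
    Real.cos (t / lam) • zlam lam y η t + (lam * Real.sin (t / lam)) • zetalam lam y η t
      = y t := by
  have h := Real.sin_sq_add_cos_sq (t / lam)
  rw [zlam, zetalam]
  match_scalars
  · field_simp
    linarith
  · ring

theorem cos_smul_zetalam_sub (lam : ℝ) (hlam : lam ≠ 0) (y η : ℝ → En n) (t : ℝ) :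
    Real.cos (t / lam) • zetalam lam y η t - (lam⁻¹ * Real.sin (t / lam)) • zlam lam y η t
      = η t := by
  have h := Real.sin_sq_add_cos_sq (t / lam)
  rw [zlam, zetalam]
  match_scalars
  · ring
  · field_simp
    linarith

theorem mul_le_sin_of_le {σ s : ℝ} (hσ0 : 0 < σ) (hσπ : σ < π) (hs0 : 0 ≤ s) (hs : s ≤ σ) :
    Real.sin σ / σ * s ≤ Real.sin s := by
  have h := strictConcaveOn_sin_Icc.concaveOn.2 (⟨le_rfl, Real.pi_pos.le⟩ : (0 : ℝ) ∈ Set.Icc 0 π)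
    (⟨hσ0.le, hσπ.le⟩ : σ ∈ Set.Icc 0 π) (sub_nonneg.2 ((div_le_one hσ0).2 hs))
    (div_nonneg hs0 hσ0.le) (sub_add_cancel 1 (s / σ))
  simp only [smul_eq_mul, mul_zero, zero_add, Real.sin_zero, div_mul_cancel₀ _ hσ0.ne'] at h
  calc Real.sin σ / σ * s = s / σ * Real.sin σ := by ring
    _ ≤ _ := h

/-- A curve whose velocity is at most `D * t ^ (-μ)` with `μ > 1` moves by at most a multiple of
`T ^ (1 - μ)` after time `T`. -/
theorem norm_sub_le_of_deriv_le_rpow {E : Type*} [NormedAddCommGroup E] [NormedSpace ℝ E]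
    {g g' : ℝ → E} {D μ T t : ℝ} (hD : 0 ≤ D) (hμ : 1 < μ) (hT : 0 < T) (hTt : T ≤ t)
    (hg : ∀ s ∈ Set.Icc T t, HasDerivAt g (g' s) s)
    (hb : ∀ s ∈ Set.Icc T t, ‖g' s‖ ≤ D * s ^ (-μ)) :
    ‖g t - g T‖ ≤ D / (μ - 1) * T ^ (1 - μ) := by
  have hμ1 : 0 < μ - 1 := by linarith
  have hB : ∀ s ∈ Set.Icc T t,
      HasDerivAt (fun s => D / (μ - 1) * (T ^ (1 - μ) - s ^ (1 - μ))) (D * s ^ (-μ)) s := by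
    intro s hs
    have h := ((Real.hasDerivAt_rpow_const (p := 1 - μ)
      (Or.inl (hT.trans_le hs.1).ne')).const_sub (T ^ (1 - μ))).const_mul (D / (μ - 1))
    refine h.congr_deriv ?_
    rw [show 1 - μ - 1 = -μ by ring]
    field_simp
    ring
  have h := image_norm_le_of_norm_deriv_right_le_deriv_boundary' (f := fun s => g s - g T)
    (fun s hs => ((hg s hs).sub_const (g T)).continuousAt.continuousWithinAt)
    (fun s hs => ((hg s ⟨hs.1, hs.2.le⟩).sub_const (g T)).hasDerivWithinAt)
    (by simp) (fun s hs => (hB s hs).continuousAt.continuousWithinAt)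
    (fun s hs => (hB s ⟨hs.1, hs.2.le⟩).hasDerivWithinAt)
    (fun s hs => hb s ⟨hs.1, hs.2.le⟩) ⟨hTt, le_rfl⟩
  refine h.trans (mul_le_mul_of_nonneg_left ?_ (by positivity))
  have : 0 ≤ t ^ (1 - μ) := Real.rpow_nonneg (hT.le.trans hTt) _
  linarith

/-- As long as the back-rotated point stays near `(z₀, ζ₀)`, the trajectory moves away linearly
and its momentum is bounded. -/
theorem flow_bounds_of_near {σ ε c lam t : ℝ} {y η : ℝ → En n} {z₀ ζ₀ : En n} (hσ0 : 0 < σ)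
    (hσπ : σ < π) (hc : c = ‖ζ₀‖) (hε : ε ≤ c / 2) (hlam : 1 ≤ lam) (ht0 : 0 ≤ t)
    (ht : t ≤ σ * lam)
    (hnear : dist (zlam lam y η t, zetalam lam y η t) (z₀, ζ₀) ≤ ε) :
    Real.sin σ / σ * t * (c / 2) - (‖z₀‖ + c / 2) ≤ ‖y t‖ ∧
      ‖η t‖ ≤ 2 * c + (‖z₀‖ + c / 2) := by
  have hlam0 : 0 < lam := by linarith
  obtain ⟨hz, hζ⟩ := max_le_iff.1 ((Prod.dist_eq).symm.trans_le hnear)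
  rw [dist_eq_norm] at hz hζ
  simp only at hz hζ
  have hzn : ‖zlam lam y η t‖ ≤ ‖z₀‖ + c / 2 := by
    linarith [norm_le_norm_add_norm_sub' (zlam lam y η t) z₀]
  have hζn : ‖zetalam lam y η t‖ ≤ 2 * c := by
    linarith [norm_le_norm_add_norm_sub' (zetalam lam y η t) ζ₀, norm_nonneg ζ₀]
  have hζl : c / 2 ≤ ‖zetalam lam y η t‖ := by
    linarith [norm_le_norm_add_norm_sub (zetalam lam y η t) ζ₀]
  have hcos := Real.abs_cos_le_one (t / lam)
  have hsin : Real.sin σ / σ * (t / lam) ≤ Real.sin (t / lam) :=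
    mul_le_sin_of_le hσ0 hσπ (by positivity) ((div_le_iff₀ hlam0).2 ht)
  have hc0 : 0 ≤ c := hc ▸ norm_nonneg _
  constructor
  · have h1 : ‖(lam * Real.sin (t / lam)) • zetalam lam y η t‖
        ≤ ‖y t‖ + ‖Real.cos (t / lam) • zlam lam y η t‖ := by
      have := norm_sub_le (y t) (Real.cos (t / lam) • zlam lam y η t)
      rwa [sub_eq_of_eq_add' (cos_smul_zlam_add lam hlam0.ne' y η t).symm] at this
    have h2 : ‖Real.cos (t / lam) • zlam lam y η t‖ ≤ ‖z₀‖ + c / 2 := by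
      rw [norm_smul, Real.norm_eq_abs]
      exact (mul_le_of_le_one_left (norm_nonneg _) hcos).trans hzn
    have h3 : Real.sin σ / σ * t ≤ lam * Real.sin (t / lam) := by
      calc Real.sin σ / σ * t = lam * (Real.sin σ / σ * (t / lam)) := by field_simp
        _ ≤ _ := mul_le_mul_of_nonneg_left hsin hlam0.le
    have h4 : Real.sin σ / σ * t * (c / 2) ≤ ‖(lam * Real.sin (t / lam)) • zetalam lam y η t‖ := by
      rw [norm_smul]
      exact mul_le_mul (h3.trans (le_abs_self _)) hζl (by positivity) (norm_nonneg _)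
    linarith
  · rw [← cos_smul_zetalam_sub lam hlam0.ne' y η t]
    refine (norm_sub_le _ _).trans (add_le_add ?_ ?_)
    · rw [norm_smul, Real.norm_eq_abs]
      exact (mul_le_of_le_one_left (norm_nonneg _) hcos).trans hζn
    · rw [norm_smul, Real.norm_eq_abs, abs_mul, abs_of_pos (inv_pos.2 hlam0)]
      exact (mul_le_of_le_one_left (norm_nonneg _)
        (mul_le_one₀ (inv_le_one_of_one_le₀ hlam) (abs_nonneg _) (Real.abs_sin_le_one _))).trans hzn

/-- Once the back-rotated trajectory is close to `(z₀, ζ₀)` with `ζ₀ ≠ 0` at a large time, it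
remains close up to time `σλ`, uniformly in `λ`. -/
theorem AssumptionA.exists_persistence {a : Fin n → Fin n → En n → ℝ} {V : En n → ℝ} {μ : ℝ}
    (hA : AssumptionA n a V μ) {σ : ℝ} (hσ0 : 0 < σ) (hσπ : σ < π) (z₀ : En n) {ζ₀ : En n}
    (hζ₀ : ζ₀ ≠ 0) :
    ∃ D T₀ : ℝ, 0 < T₀ ∧ ∀ (ε ρ T lam : ℝ) (y η : ℝ → En n), ε ≤ ‖ζ₀‖ / 2 → T₀ ≤ T →
      1 ≤ lam → T ≤ σ * lam → IsFlowPlam a V lam y η →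
      dist (zlam lam y η T, zetalam lam y η T) (z₀, ζ₀) ≤ ρ → ρ + D * T ^ (1 - μ) < ε →
      dist (zlam lam y η (σ * lam), zetalam lam y η (σ * lam)) (z₀, ζ₀) < ε := by
  set c := ‖ζ₀‖ with hc
  have hc0 : 0 < c := norm_pos_iff.2 hζ₀
  set M := ‖z₀‖ + c / 2 with hMdef
  have hM : 0 ≤ M := by positivity
  have hsinσ : 0 < Real.sin σ := Real.sin_pos_of_pos_of_lt_pi hσ0 hσπ
  set r := Real.sin σ / σ * (c / 4) with hr
  have hr0 : 0 < r := by positivity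
  obtain ⟨D, hD, hdrift⟩ := hA.exists_drift_bound hr0 (by positivity : 0 ≤ 2 * c + M) hσ0
  have hμ1 : 0 < μ - 1 := by linarith [hA.one_lt_mu]
  refine ⟨D / (μ - 1), max 1 (M / r), by positivity,
    fun ε ρ T lam y η hε hT hlam hTlam hflow hρ hsmall => ?_⟩
  have hT1 : 1 ≤ T := (le_max_left _ _).trans hT
  have hTM : M ≤ r * T := (div_le_iff₀' hr0).1 ((le_max_right _ _).trans hT)
  have hT0 : 0 < T := by linarith
  have hlam0 : 0 < lam := by linarith
  have hz := hflow.hasDerivAt_zlam hlam0.ne'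
  have hζ := hflow.hasDerivAt_zetalam hlam0.ne'
  have hg := fun t => (hz t).prodMk (hζ t)
  have hcont : Continuous fun t => (zlam lam y η t, zetalam lam y η t) :=
    continuous_iff_continuousAt.2 fun t => (hg t).continuousAt
  refine lt_of_self_improving_bound
    (f := fun t => dist (zlam lam y η t, zetalam lam y η t) (z₀, ζ₀))
    (hcont.dist continuous_const).continuousOn
    (lt_of_le_of_lt (hρ.trans (le_add_of_nonneg_right (by positivity))) hsmall) ?_
    (σ * lam) ⟨hTlam, le_rfl⟩
  intro t ht hle
  have hmove := norm_sub_le_of_deriv_le_rpow hD hA.one_lt_mu hT0 ht.1 (fun s _ => hg s) ?_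
  · rw [← dist_eq_norm] at hmove
    exact lt_of_le_of_lt ((dist_triangle_left _ _ _).trans
      (add_le_add ((dist_comm _ _).trans_le hmove) hρ)) (by linarith)
  intro s hs
  have hs1 : 1 ≤ s := hT1.trans hs.1
  have hs0 : 0 < s := by linarith
  have hslam : s ≤ σ * lam := hs.2.trans ht.2
  obtain ⟨hy, hη⟩ := flow_bounds_of_near hσ0 hσπ hc hε hlam hs0.le hslam (hle s hs)
  have hy' : r * s ≤ ‖y s‖ := by
    have h1 : r * T ≤ r * s := mul_le_mul_of_nonneg_left hs.1 hr0.le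
    have h2 : Real.sin σ / σ * s * (c / 2) = 2 * (r * s) := by rw [hr]; ring
    linarith
  have hinv : lam⁻¹ ≤ σ / s := by
    rw [inv_eq_one_div, div_le_div_iff₀ hlam0 hs0]; linarith
  have hinv1 : lam⁻¹ ≤ 1 := inv_le_one_of_one_le₀ hlam
  have hsin1 := Real.abs_sin_le_one (s / lam)
  have hcos1 := Real.abs_cos_le_one (s / lam)
  have hbeta : |lam * Real.sin (s / lam)| ≤ s := by
    rw [abs_mul, abs_of_pos hlam0]
    calc lam * |Real.sin (s / lam)| ≤ lam * |s / lam| :=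
          mul_le_mul_of_nonneg_left Real.abs_sin_le_abs hlam0.le
      _ = s := by rw [abs_of_pos (by positivity)]; field_simp
  rw [Prod.norm_def]
  refine max_le (hdrift lam s _ _ (y s, η s) hs1 hcos1 hbeta ?_ hy' hη)
    (hdrift lam s _ _ (y s, η s) hs1 ?_ ?_ ?_ hy' hη)
  · refine le_trans ?_ hinv
    rw [abs_mul, abs_of_pos hlam0]
    calc lam * |Real.sin (s / lam)| * (lam ^ 2)⁻¹ ≤ lam * 1 * (lam ^ 2)⁻¹ := by gcongr
      _ = lam⁻¹ := by field_simp
  · rw [abs_mul, abs_of_pos (inv_pos.2 hlam0)]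
    exact mul_le_one₀ hinv1 (abs_nonneg _) hsin1
  · rw [abs_neg]; exact hcos1.trans hs1
  · refine le_trans ?_ hinv
    rw [abs_neg]
    calc |Real.cos (s / lam)| * (lam ^ 2)⁻¹ ≤ 1 * (lam ^ 2)⁻¹ := by gcongr
      _ = lam⁻¹ * lam⁻¹ := by rw [one_mul, pow_two, mul_inv]
      _ ≤ lam⁻¹ := mul_le_of_le_one_left (by positivity) hinv1

/-- A trajectory that escapes at least linearly has nonzero asymptotic momentum. -/
theorem asymptotic_momentum_ne_zero {y η : ℝ → En n} {xp ξp : En n} {c₁ c₂ : ℝ} (hc₁ : 0 < c₁)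
    (hy : ∀ t, 0 ≤ t → c₁ * t - c₂ ≤ ‖y t‖)
    (hxp : Tendsto (fun t : ℝ => y t - t • η t) atTop (𝓝 xp))
    (hξp : Tendsto η atTop (𝓝 ξp)) : ξp ≠ 0 := by
  rintro rfl
  have h1 : ∀ᶠ t in atTop, ‖η t‖ < c₁ / 2 :=
    (by simpa using hξp.norm : Tendsto (fun t => ‖η t‖) atTop (𝓝 0)).eventually
      (gt_mem_nhds (by positivity))
  have h2 : ∀ᶠ t in atTop, ‖y t - t • η t‖ < ‖xp‖ + 1 :=
    hxp.norm.eventually (gt_mem_nhds (by linarith))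
  obtain ⟨t, ht1, ht2, ht3, ht0⟩ := (h1.and (h2.and
    ((eventually_ge_atTop ((‖xp‖ + 1 + c₂) / (c₁ / 2))).and (eventually_ge_atTop 0)))).exists
  have h3 := (div_le_iff₀' (by positivity : 0 < c₁ / 2)).1 ht3
  have h4 : ‖t • η t‖ ≤ t * (c₁ / 2) := by
    rw [norm_smul, Real.norm_eq_abs, abs_of_nonneg ht0]
    exact mul_le_mul_of_nonneg_left ht1.le ht0
  have h5 := norm_le_norm_add_norm_sub' (y t) (t • η t)
  have h6 := hy t ht0
  linarith

/-- For fixed time, the rotations by angle `T / λ` converge to free motion as `λ → ∞`. -/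
theorem tendsto_zlam_zetalam {Y H : ℝ → ℝ → En n} {T : ℝ} {x ξ : En n}
    (h : Tendsto (fun lam => (Y lam T, H lam T)) atTop (𝓝 (x, ξ))) :
    Tendsto (fun lam => (zlam lam (Y lam) (H lam) T, zetalam lam (Y lam) (H lam) T)) atTop
      (𝓝 (x - T • ξ, ξ)) := by
  have hY : Tendsto (fun lam => Y lam T) atTop (𝓝 x) := (continuous_fst.tendsto _).comp h
  have hH : Tendsto (fun lam => H lam T) atTop (𝓝 ξ) := (continuous_snd.tendsto _).comp h
  have hdiv : Tendsto (fun lam : ℝ => T / lam) atTop (𝓝 0) :=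
    tendsto_const_nhds.div_atTop tendsto_id
  have hcos : Tendsto (fun lam : ℝ => Real.cos (T / lam)) atTop (𝓝 1) := by
    simpa [Function.comp_def] using (Real.continuous_cos.tendsto 0).comp hdiv
  have hsin : Tendsto (fun lam : ℝ => Real.sin (T / lam)) atTop (𝓝 0) := by
    simpa [Function.comp_def] using (Real.continuous_sin.tendsto 0).comp hdiv
  have hinv : Tendsto (fun lam : ℝ => lam⁻¹ * Real.sin (T / lam)) atTop (𝓝 0) := by
    simpa using tendsto_inv_atTop_zero.mul hsin
  have hlsin : Tendsto (fun lam : ℝ => lam * Real.sin (T / lam)) atTop (𝓝 T) := by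
    have hder : HasDerivAt (fun s : ℝ => Real.sin (T * s)) T 0 := by
      simpa using ((hasDerivAt_id (0 : ℝ)).const_mul T).sin
    have hslope := hder.tendsto_slope_zero_right.comp tendsto_inv_atTop_nhdsGT_zero
    refine hslope.congr fun lam => ?_
    simp [div_eq_mul_inv]
  refine Tendsto.prodMk_nhds ?_ ?_
  · simpa [zlam] using (hcos.smul hY).sub (hlsin.smul hH)
  · simpa [zetalam] using (hinv.smul hY).add (hcos.smul hH)

end PhaseSpace

/-- Lemma 2.3. Under Assumption A, suppose `(x₀,ξ₀)` is forward
nontrapping for `k`, the `ξ`-component of `S₊(x₀,ξ₀)` is nonzero, and `Ω ∋ (x₀,ξ₀)` is a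
sufficiently small neighborhood (as in the escape estimate, with parameter `δ`). Then for
every `σ ∈ (0,π)` and `(x,ξ) ∈ Ω`,
`lim_{λ→∞} exp(−σλH_{p₀^λ}) ∘ exp(σλH_{p^λ})(x,ξ) = S₊(x,ξ)`. -/
theorem stmt_12 {n : ℕ} (a : Fin n → Fin n → En n → ℝ) (V : En n → ℝ) (μ : ℝ)
    (hA : AssumptionA n a V μ) (x₀ ξ₀ : En n)
    -- forward nontrapping of (x₀,ξ₀), with scattering data (x₀₊, ξ₀₊), ξ₀₊ ≠ 0:
    (y₀ η₀ : ℝ → En n) (hflow₀ : IsFlowK a y₀ η₀) (hy₀ : y₀ 0 = x₀) (hη₀ : η₀ 0 = ξ₀)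
    (hnt : Filter.Tendsto (fun t => ‖y₀ t‖) Filter.atTop Filter.atTop)
    (x₀p ξ₀p : En n)
    (hx₀p : Filter.Tendsto (fun t : ℝ => y₀ t - t • η₀ t) Filter.atTop (nhds x₀p))
    (hξ₀p : Filter.Tendsto η₀ Filter.atTop (nhds ξ₀p)) (hξ₀pne : ξ₀p ≠ 0)
    -- δ and Ω as in the escape estimate (Lemma 2.1):
    (δ : ℝ) (hδ : 0 < δ) (Ω : Set (En n × En n)) (hΩ : IsOpen Ω) (hmem : (x₀, ξ₀) ∈ Ω)
    (lam₀ c₁ c₂ : ℝ) (hlam₀ : 0 < lam₀) (hc₁ : 0 < c₁) (hc₂ : 0 < c₂)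
    (hescape : ∀ lam : ℝ, lam₀ ≤ lam → ∀ x ξ : En n, (x, ξ) ∈ Ω →
      ∀ y η : ℝ → En n, IsFlowPlam a V lam y η → y 0 = x → η 0 = ξ →
        ∀ t : ℝ, 0 ≤ t → t ≤ lam * δ → c₁ * t - c₂ ≤ ‖y t‖)
    -- σ ∈ (0,π) and (x,ξ) ∈ Ω:
    (σ : ℝ) (hσ0 : 0 < σ) (hσπ : σ < π) (x ξ : En n) (hxξ : (x, ξ) ∈ Ω)
    -- classical scattering data S₊(x,ξ) = (x₊,ξ₊):
    (ty tη : ℝ → En n) (hk : IsFlowK a ty tη) (hty0 : ty 0 = x) (htη0 : tη 0 = ξ)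
    (xp ξp : En n)
    (hxp : Filter.Tendsto (fun t : ℝ => ty t - t • tη t) Filter.atTop (nhds xp))
    (hξp : Filter.Tendsto tη Filter.atTop (nhds ξp))
    -- the flows of p^λ with initial data (x,ξ):
    (Y H : ℝ → ℝ → En n)
    (hYH : ∀ lam : ℝ, 0 < lam →
      IsFlowPlam a V lam (Y lam) (H lam) ∧ Y lam 0 = x ∧ H lam 0 = ξ) :
    Filter.Tendsto (fun lam : ℝ =>
        (zlam lam (Y lam) (H lam) (σ * lam), zetalam lam (Y lam) (H lam) (σ * lam)))
      Filter.atTop (nhds (xp, ξp)) := by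
  have hT (T : ℝ) (hT0 : 0 ≤ T) := tendsto_flowPlam hA hk hty0 htη0 hYH hT0
  have hlin : ∀ t, 0 ≤ t → c₁ * t - c₂ ≤ ‖ty t‖ := fun t ht => by
    have hlim : Tendsto (fun lam => ‖Y lam t‖) atTop (𝓝 ‖ty t‖) :=
      ((continuous_fst.tendsto _).comp (hT t ht)).norm
    refine ge_of_tendsto hlim ?_
    filter_upwards [eventually_gt_atTop 0, eventually_ge_atTop lam₀,
      eventually_ge_atTop (t / δ)] with lam h0 h1 h2
    obtain ⟨hf, hy, hη⟩ := hYH lam h0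
    exact hescape lam h1 x ξ hxξ _ _ hf hy hη t ht ((div_le_iff₀ hδ).1 h2)
  have hξpne : ξp ≠ 0 := asymptotic_momentum_ne_zero hc₁ hlin hxp hξp
  obtain ⟨D, T₀, hT₀, hpersist⟩ := hA.exists_persistence hσ0 hσπ xp hξpne
  rw [Metric.tendsto_nhds]
  intro ε' hε'
  set ε := min ε' (‖ξp‖ / 2)
  have hε : 0 < ε := lt_min hε' (by positivity)
  have hpow : Tendsto (fun T : ℝ => D * T ^ (1 - μ)) atTop (𝓝 0) := by
    have h := tendsto_rpow_neg_atTop (by linarith [hA.one_lt_mu] : 0 < μ - 1)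
    simpa using h.const_mul D
  have hfree : Tendsto (fun t => (ty t - t • tη t, tη t)) atTop (𝓝 (xp, ξp)) :=
    hxp.prodMk_nhds hξp
  obtain ⟨T, hTT₀, hDT, hdT⟩ := ((eventually_ge_atTop T₀).and
    ((hpow.eventually (gt_mem_nhds (by positivity : 0 < ε / 3))).and
      (Metric.tendsto_nhds.1 hfree (ε / 3) (by positivity)))).exists
  filter_upwards [eventually_ge_atTop 1, eventually_ge_atTop (T / σ),
    Metric.tendsto_nhds.1 (tendsto_zlam_zetalam (hT T (hT₀.le.trans hTT₀))) (ε / 3)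
      (by positivity)] with lam h1 hTlam hclose
  refine (hpersist ε (2 * (ε / 3)) T lam (Y lam) (H lam) (min_le_right _ _) hTT₀ h1
    ((div_le_iff₀' hσ0).1 hTlam) (hYH lam (by linarith)).1 ?_ (by linarith)).trans_le
    (min_le_left _ _)
  exact (dist_triangle _ (ty T - T • tη T, tη T) _).trans (by linarith)
end

section
/- (Theorem 2.4 (i).) Under Assumption A, suppose (x₀,ξ₀) is forward nontrapping with respect to k, and let 0 < σ < π. Then there exists a neighborhood Ω of (x₀,ξ₀) such that, uniformly for (x,ξ) ∈ Ω, lim_{λ→∞} π₁( exp(−σH_{p₀}) ∘ exp(σH_p)(x, λξ) ) = π₁(S₊(x,ξ)) and lim_{λ→∞} λ^{−1} π₂( exp(−σH_{p₀}) ∘ exp(σH_p)(x, λξ) ) = π₂(S₊(x,ξ)). -/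
open Real Filter
open scoped BigOperators Topology

namespace HarmonicScattering

open Set

section Calculus

/-- A continuous function stays below `δ` on `[a, b]` if being below `δ` before time `t` forces it
to be below `δ` at time `t`. -/
theorem lt_of_forall_Ico_lt {f : ℝ → ℝ} {a b δ : ℝ} (hf : ContinuousOn f (Icc a b))
    (h : ∀ t ∈ Icc a b, (∀ s ∈ Ico a t, f s < δ) → f t < δ) : ∀ t ∈ Icc a b, f t < δ := by
  by_contra! hcon
  obtain ⟨t₀, ht₀, hft₀⟩ := hcon
  have hclosed : IsClosed (Icc a b ∩ f ⁻¹' Ici δ) :=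
    hf.preimage_isClosed_of_isClosed isClosed_Icc isClosed_Ici
  have hbdd : BddBelow (Icc a b ∩ f ⁻¹' Ici δ) := ⟨a, fun x hx => hx.1.1⟩
  have hmem := hclosed.csInf_mem ⟨t₀, ht₀, hft₀⟩ hbdd
  refine absurd (h _ hmem.1 fun s hs => ?_) (not_lt.2 hmem.2)
  by_contra! hs'
  exact absurd (csInf_le hbdd ⟨⟨hs.1, hs.2.le.trans hmem.1.2⟩, hs'⟩) (not_le.2 hs.2)

variable {X : Type*} [NormedAddCommGroup X] [NormedSpace ℝ X]

theorem norm_sub_le_of_norm_deriv_le_rpow {F F' : ℝ → X} {μ D T t : ℝ} (hμ : 1 < μ) (hD : 0 ≤ D)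
    (hT : 0 < T) (hTt : T ≤ t) (hF : ∀ s, HasDerivAt F (F' s) s)
    (hF' : ∀ s ∈ Ico T t, ‖F' s‖ ≤ D * s ^ (-μ)) :
    ‖F t - F T‖ ≤ D / (μ - 1) * T ^ (1 - μ) := by
  have hμ' : 0 < μ - 1 := by linarith
  have hB : ∀ s, 0 < s → HasDerivAt (fun s : ℝ => D / (μ - 1) * (T ^ (1 - μ) - s ^ (1 - μ)))
      (D * s ^ (-μ)) s := fun s hs => by
    have h := (((Real.hasDerivAt_rpow_const (p := 1 - μ) (Or.inl hs.ne')).const_sub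
      (T ^ (1 - μ))).const_mul (D / (μ - 1)))
    refine h.congr_deriv ?_
    rw [show 1 - μ - 1 = -μ by ring]
    field_simp
    ring
  have key := image_norm_le_of_norm_deriv_right_le_deriv_boundary' (f := fun s => F s - F T)
    (f' := F') (a := T) (b := t) (B := fun s : ℝ => D / (μ - 1) * (T ^ (1 - μ) - s ^ (1 - μ)))
    (B' := fun s => D * s ^ (-μ))
    (fun s _ => ((hF s).sub_const _).continuousAt.continuousWithinAt)
    (fun s _ => ((hF s).sub_const _).hasDerivWithinAt) (by simp)
    (fun s hs => (hB s (hT.trans_le hs.1)).continuousAt.continuousWithinAt)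
    (fun s hs => (hB s (hT.trans_le hs.1)).hasDerivWithinAt) hF' (right_mem_Icc.2 hTt)
  refine key.trans (mul_le_mul_of_nonneg_left ?_ (div_nonneg hD hμ'.le))
  have : 0 ≤ t ^ (1 - μ) := Real.rpow_nonneg (hT.le.trans hTt) _
  linarith

theorem tendsto_mul_rpow_one_sub {μ : ℝ} (hμ : 1 < μ) (D : ℝ) :
    Tendsto (fun T : ℝ => D / (μ - 1) * T ^ (1 - μ)) atTop (𝓝 0) := by
  have h := (tendsto_rpow_neg_atTop (show 0 < μ - 1 by linarith)).const_mul (D / (μ - 1))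
  simpa [neg_sub] using h

end Calculus

section Harmonic

/-- The function `sin (ε t) / ε`, extended by `t` to `ε = 0`. -/
noncomputable def sine (ε t : ℝ) : ℝ := t * sinc (ε * t)

theorem mul_sine (ε t : ℝ) : ε * sine ε t = sin (ε * t) := by
  rcases eq_or_ne (ε * t) 0 with h | h
  · rw [sine, ← mul_assoc, h]; simp
  · rw [sine, sinc_of_ne_zero h, ← mul_assoc, mul_div_cancel₀ _ h]

theorem sine_zero (t : ℝ) : sine 0 t = t := by simp [sine]

theorem continuous_sine (t : ℝ) : Continuous fun ε => sine ε t := by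
  unfold sine; fun_prop

theorem hasDerivAt_sine (ε t : ℝ) : HasDerivAt (sine ε) (cos (ε * t)) t := by
  rcases eq_or_ne ε 0 with rfl | h
  · simpa [funext sine_zero] using hasDerivAt_id' t
  · have hs : sine ε = fun t => sin (ε * t) / ε := by
      ext t; rw [← mul_sine, mul_div_cancel_left₀ _ h]
    rw [hs]
    have := (((hasDerivAt_id' t).const_mul ε).sin).div_const ε
    refine this.congr_deriv ?_
    field_simp

theorem hasDerivAt_cos_mul (ε t : ℝ) :
    HasDerivAt (fun t => cos (ε * t)) (-(ε ^ 2 * sine ε t)) t := by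
  have := ((hasDerivAt_id' t).const_mul ε).cos
  refine this.congr_deriv ?_
  rw [sq, mul_assoc, mul_sine]; ring

theorem cos_sq_add_sine_sq (ε t : ℝ) : cos (ε * t) ^ 2 + ε ^ 2 * sine ε t ^ 2 = 1 := by
  rw [← mul_pow, mul_sine, cos_sq_add_sin_sq]

theorem abs_sine_le (ε : ℝ) {t : ℝ} (ht : 0 ≤ t) : |sine ε t| ≤ t := by
  rw [sine, abs_mul, abs_of_nonneg ht]
  exact mul_le_of_le_one_right ht (abs_sinc_le_one _)

theorem abs_sq_mul_sine_le {ε : ℝ} (hε : 0 ≤ ε) (t : ℝ) : |ε ^ 2 * sine ε t| ≤ ε := by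
  rw [sq, mul_assoc, mul_sine, abs_mul, abs_of_nonneg hε]
  exact mul_le_of_le_one_right hε (abs_sin_le_one _)

theorem sinc_mul_le_sine {ε t σ : ℝ} (hε : 0 ≤ ε) (ht : 0 ≤ t) (hσ : 0 < σ) (hσπ : σ < π)
    (h : ε * t ≤ σ) : sinc σ * t ≤ sine ε t := by
  rw [sine, mul_comm]
  refine mul_le_mul_of_nonneg_left ?_ ht
  rcases (mul_nonneg hε ht).eq_or_lt with h0 | h0
  · rw [← h0, sinc_zero]; exact sinc_le_one σ
  · rw [sinc_of_ne_zero hσ.ne', sinc_of_ne_zero h0.ne', div_le_div_iff₀ hσ h0]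
    have hc := strictConcaveOn_sin_Icc.concaveOn.2 (left_mem_Icc.2 pi_pos.le)
      (show σ ∈ Icc 0 π from ⟨hσ.le, hσπ.le⟩)
      (show 0 ≤ 1 - ε * t / σ from sub_nonneg.2 ((div_le_one hσ).2 h))
      (show 0 ≤ ε * t / σ by positivity) (by ring)
    simp only [smul_eq_mul, sin_zero, mul_zero, zero_add] at hc
    rw [div_mul_cancel₀ _ hσ.ne', div_mul_eq_mul_div, div_le_iff₀ hσ] at hc
    linarith

theorem sinc_pos {σ : ℝ} (hσ : 0 < σ) (hσπ : σ < π) : 0 < sinc σ := by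
  rw [sinc_of_ne_zero hσ.ne']
  exact div_pos (sin_pos_of_pos_of_lt_pi hσ hσπ) hσ

variable {E : Type*} [NormedAddCommGroup E] [InnerProductSpace ℝ E]

/-- The backward flow at time `t` of the harmonic oscillator `(|ξ|² + ε² |x|²) / 2`. -/
noncomputable def back (ε t : ℝ) (q : E × E) : E × E :=
  (cos (ε * t) • q.1 - sine ε t • q.2, (ε ^ 2 * sine ε t) • q.1 + cos (ε * t) • q.2)

theorem back_zero (t : ℝ) (q : E × E) : back 0 t q = (q.1 - t • q.2, q.2) := by
  simp [back, sine_zero]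

theorem continuous_back (t : ℝ) : Continuous fun p : ℝ × (E × E) => back p.1 t p.2 := by
  have := continuous_sine t
  unfold back
  fun_prop

theorem fst_eq_of_back (ε t : ℝ) (q : E × E) :
    q.1 = cos (ε * t) • (back ε t q).1 + sine ε t • (back ε t q).2 := by
  have h := cos_sq_add_sine_sq ε t
  simp only [back]
  match_scalars
  · linarith
  · ring

theorem snd_eq_of_back (ε t : ℝ) (q : E × E) :
    q.2 = cos (ε * t) • (back ε t q).2 - (ε ^ 2 * sine ε t) • (back ε t q).1 := by
  have h := cos_sq_add_sine_sq ε t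
  simp only [back]
  match_scalars
  · linarith
  · ring

end Harmonic

section Perturbation

variable {E : Type*} [NormedAddCommGroup E] [InnerProductSpace ℝ E]

/-- Short-range bounds for the vector field `(b, -(g + ε² (x + W)))` relative to the harmonic
oscillator `(|ξ|² + ε² |x|²) / 2`. -/
structure ShortRange (μ C : ℝ) (b g : E → E → E) (W : E → E) : Prop where
  one_lt : 1 < μ
  nonneg : 0 ≤ C
  contDiff_b : ContDiff ℝ 1 fun q : E × E => b q.1 q.2
  contDiff_g : ContDiff ℝ 1 fun q : E × E => g q.1 q.2
  continuous_W : Continuous W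
  norm_b_sub_le : ∀ y η r, 0 < r → r ≤ ‖y‖ → ‖b y η - η‖ ≤ C * r ^ (-μ) * ‖η‖
  norm_g_le : ∀ y η r, 0 < r → r ≤ ‖y‖ → ‖g y η‖ ≤ C * r ^ (-1 - μ) * ‖η‖ ^ 2
  norm_W_le : ∀ y r, 0 < r → r ≤ ‖y‖ → ‖W y‖ ≤ C * r ^ (1 - μ)

/-- `(y, η)` is an integral curve of the vector field `(b, -(g + ε² (x + W)))`. -/
structure IsCurve (b g : E → E → E) (W : E → E) (ε : ℝ) (y η : ℝ → E) : Prop where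
  deriv_fst : ∀ t, HasDerivAt y (b (y t) (η t)) t
  deriv_snd : ∀ t, HasDerivAt η (-(g (y t) (η t) + ε ^ 2 • (y t + W (y t)))) t

variable {b g : E → E → E} {W : E → E} {μ C ε : ℝ} {y η : ℝ → E}

/-- The derivative of `t ↦ back ε t (y t, η t)` along an integral curve. -/
noncomputable def backDeriv (b g : E → E → E) (W : E → E) (ε t : ℝ) (y η : E) : E × E :=
  (cos (ε * t) • (b y η - η) + sine ε t • (g y η + ε ^ 2 • W y),
    (ε ^ 2 * sine ε t) • (b y η - η) - cos (ε * t) • (g y η + ε ^ 2 • W y))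

theorem IsCurve.hasDerivAt_back (h : IsCurve b g W ε y η) (t : ℝ) :
    HasDerivAt (fun t => back ε t (y t, η t)) (backDeriv b g W ε t (y t) (η t)) t := by
  have hc := hasDerivAt_cos_mul ε t
  have hs := hasDerivAt_sine ε t
  have hy := h.deriv_fst t
  have hη := h.deriv_snd t
  refine ((hc.smul hy).sub (hs.smul hη)).prodMk (((hs.const_mul (ε ^ 2)).smul hy).add
    (hc.smul hη)) |>.congr_deriv ?_
  refine Prod.ext ?_ ?_ <;> simp only [backDeriv] <;> module

theorem IsCurve.continuous (h : IsCurve b g W ε y η) : Continuous fun t => (y t, η t) :=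
  continuous_iff_continuousAt.2 fun t =>
    ((h.deriv_fst t).prodMk (h.deriv_snd t)).continuousAt

theorem ShortRange.norm_backDeriv_le (h : ShortRange μ C b g W) {t ρ N : ℝ} {y η : E}
    (hε0 : 0 ≤ ε) (hε1 : ε ≤ 1) (ht : 1 ≤ t) (hεt : ε * t ≤ 4) (hρ : 0 < ρ)
    (hy : ρ * t ≤ ‖y‖) (hη : ‖η‖ ≤ N) :
    ‖backDeriv b g W ε t y η‖ ≤
      C * (ρ ^ (-μ) * N + ρ ^ (-1 - μ) * N ^ 2 + 16 * ρ ^ (1 - μ)) * t ^ (-μ) := by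
  have ht0 : 0 < t := by linarith
  have hρt : 0 < ρ * t := by positivity
  have hN : 0 ≤ N := (norm_nonneg η).trans hη
  have hC := h.nonneg
  have hr1 : t * t ^ (-1 - μ) = t ^ (-μ) := by
    rw [← Real.rpow_one_add' ht0.le (by have := h.one_lt; linarith)]; ring_nf
  have hr2 : t * t ^ (1 - μ) = t ^ 2 * t ^ (-μ) := by
    rw [show (1 : ℝ) - μ = 1 + -μ by ring, Real.rpow_add ht0, Real.rpow_one]; ring
  have hP : ‖b y η - η‖ ≤ C * (ρ ^ (-μ) * N) * t ^ (-μ) := by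
    have h1 := h.norm_b_sub_le y η _ hρt hy
    rw [Real.mul_rpow hρ.le ht0.le] at h1
    calc _ ≤ _ := h1
      _ ≤ C * (ρ ^ (-μ) * t ^ (-μ)) * N := by gcongr
      _ = _ := by ring
  have hQ : t * ‖g y η + ε ^ 2 • W y‖ ≤
      C * (ρ ^ (-1 - μ) * N ^ 2 + 16 * ρ ^ (1 - μ)) * t ^ (-μ) := by
    have h1 := h.norm_g_le y η _ hρt hy
    have h2 := h.norm_W_le y _ hρt hy
    rw [Real.mul_rpow hρ.le ht0.le] at h1 h2
    have h3 : (ε * t) ^ 2 ≤ 16 := by nlinarith [mul_nonneg hε0 ht0.le]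
    calc t * ‖g y η + ε ^ 2 • W y‖ ≤ t * (‖g y η‖ + ε ^ 2 * ‖W y‖) := by
          gcongr
          refine (norm_add_le _ _).trans ?_
          rw [norm_smul, Real.norm_of_nonneg (sq_nonneg ε)]
      _ ≤ t * (C * (ρ ^ (-1 - μ) * t ^ (-1 - μ)) * N ^ 2 +
            ε ^ 2 * (C * (ρ ^ (1 - μ) * t ^ (1 - μ)))) := by
          gcongr
          exact h1.trans (by gcongr)
      _ = C * ρ ^ (-1 - μ) * N ^ 2 * (t * t ^ (-1 - μ)) +
            ε ^ 2 * C * ρ ^ (1 - μ) * (t * t ^ (1 - μ)) := by ring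
      _ = C * (ρ ^ (-1 - μ) * N ^ 2 + (ε * t) ^ 2 * ρ ^ (1 - μ)) * t ^ (-μ) := by
          rw [hr1, hr2]; ring
      _ ≤ _ := by gcongr
  have hsum : ‖b y η - η‖ + t * ‖g y η + ε ^ 2 • W y‖ ≤
      C * (ρ ^ (-μ) * N + ρ ^ (-1 - μ) * N ^ 2 + 16 * ρ ^ (1 - μ)) * t ^ (-μ) := by
    linarith
  refine le_trans ?_ hsum
  rw [backDeriv, Prod.norm_mk]
  refine max_le ?_ ?_
  · refine (norm_add_le _ _).trans ?_
    rw [norm_smul, norm_smul]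
    gcongr
    · exact mul_le_of_le_one_left (norm_nonneg _) (abs_cos_le_one _)
    · exact abs_sine_le ε ht0.le
  · refine (norm_sub_le _ _).trans ?_
    rw [norm_smul, norm_smul]
    gcongr
    · exact mul_le_of_le_one_left (norm_nonneg _) ((abs_sq_mul_sine_le hε0 t).trans hε1)
    · exact (abs_cos_le_one _).trans ht

/-- A nontrapped geodesic is asymptotically free, with nonzero asymptotic momentum. -/
theorem ShortRange.exists_bounds_of_tendsto (h : ShortRange μ C b g W)
    (hc : IsCurve b g W 0 y η) {e : ℝ} (he : 0 < e) (hen : ∀ t, inner ℝ (b (y t) (η t)) (η t) = e)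
    (hnt : Tendsto (fun t => ‖y t‖) atTop atTop) :
    ∃ Z m M T₁ : ℝ, 0 < m ∧ ∀ t, T₁ ≤ t →
      ‖(back 0 t (y t, η t)).1‖ ≤ Z ∧ m ≤ ‖(back 0 t (y t, η t)).2‖ ∧
        ‖(back 0 t (y t, η t)).2‖ ≤ M := by
  have hμ := h.one_lt
  have hev : ∀ᶠ t in atTop, C * ‖y t‖ ^ (-μ) ≤ 1 / 4 ∧ 0 < ‖y t‖ := by
    have h1 : Tendsto (fun t => C * ‖y t‖ ^ (-μ)) atTop (𝓝 0) := by
      simpa using (((tendsto_rpow_neg_atTop (show 0 < μ by linarith)).comp hnt).const_mul C)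
    exact (h1.eventually_le_const (by norm_num)).and (hnt.eventually_gt_atTop 0)
  obtain ⟨T₁, hT₁⟩ := eventually_atTop.1 hev
  have hη : ∀ t, T₁ ≤ t → 3 / 4 * ‖η t‖ ^ 2 ≤ e ∧ e ≤ 5 / 4 * ‖η t‖ ^ 2 := by
    intro t ht
    obtain ⟨h1, h2⟩ := hT₁ t ht
    have h3 : ‖b (y t) (η t) - η t‖ ≤ 1 / 4 * ‖η t‖ :=
      (h.norm_b_sub_le _ _ _ h2 le_rfl).trans (by gcongr)
    have h4 : |inner ℝ (b (y t) (η t) - η t) (η t)| ≤ 1 / 4 * ‖η t‖ ^ 2 := by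
      refine (abs_real_inner_le_norm _ _).trans ?_
      nlinarith [norm_nonneg (η t)]
    rw [inner_sub_left, hen, real_inner_self_eq_norm_sq, abs_le] at h4
    constructor <;> linarith
  set M := √(4 / 3 * e) with hM
  set m := √(4 / 5 * e) with hm
  have hMpos : 0 < M := Real.sqrt_pos.2 (by positivity)
  have hηM : ∀ t, T₁ ≤ t → m ≤ ‖η t‖ ∧ ‖η t‖ ≤ M := fun t ht =>
    ⟨Real.sqrt_le_iff.2 ⟨norm_nonneg _, by linarith [(hη t ht).2]⟩,
      Real.le_sqrt_of_sq_le (by linarith [(hη t ht).1])⟩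
  have hgrow : ∀ t, T₁ ≤ t →
      inner ℝ (y T₁) (η T₁) + 2 / 3 * e * (t - T₁) ≤ inner ℝ (y t) (η t) := by
    intro t ht
    have hder : ∀ s, HasDerivAt (fun s => inner ℝ (y s) (η s))
        (e - inner ℝ (y s) (g (y s) (η s))) s := fun s => by
      refine ((hc.deriv_fst s).inner ℝ (hc.deriv_snd s)).congr_deriv ?_
      rw [hen]
      simp [inner_neg_right]
      ring
    have := image_le_of_deriv_right_le_deriv_boundary (a := T₁) (b := t)
      (f := fun s => inner ℝ (y T₁) (η T₁) + 2 / 3 * e * (s - T₁)) (f' := fun _ => 2 / 3 * e)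
      (B := fun s => inner ℝ (y s) (η s)) (B' := fun s => e - inner ℝ (y s) (g (y s) (η s)))
      (by fun_prop)
      (fun s _ => by
        have := ((((hasDerivAt_id' s).sub_const T₁).const_mul (2 / 3 * e)).const_add
          (inner ℝ (y T₁) (η T₁)))
        simpa using this.hasDerivWithinAt) (by simp)
      (fun s _ => (hder s).continuousAt.continuousWithinAt)
      (fun s _ => (hder s).hasDerivWithinAt) (fun s hs => ?_)
    · exact this (right_mem_Icc.2 ht)
    · obtain ⟨h1, h2⟩ := hT₁ s hs.1
      have h3 : ‖y s‖ * ‖y s‖ ^ (-1 - μ) = ‖y s‖ ^ (-μ) := by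
        rw [← Real.rpow_one_add' h2.le (by linarith)]; ring_nf
      have h4 : inner ℝ (y s) (g (y s) (η s)) ≤ 1 / 4 * ‖η s‖ ^ 2 := by
        calc _ ≤ ‖y s‖ * ‖g (y s) (η s)‖ := real_inner_le_norm _ _
          _ ≤ ‖y s‖ * (C * ‖y s‖ ^ (-1 - μ) * ‖η s‖ ^ 2) := by
            gcongr; exact h.norm_g_le _ _ _ h2 le_rfl
          _ = C * (‖y s‖ * ‖y s‖ ^ (-1 - μ)) * ‖η s‖ ^ 2 := by ring
          _ ≤ _ := by rw [h3]; gcongr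
      linarith [(hη s hs.1).1]
  set ρ := e / (2 * M) with hρ
  have hρpos : 0 < ρ := by positivity
  obtain ⟨T₂, hT₂⟩ : ∃ T₂, ∀ t, T₂ ≤ t → T₁ ≤ t → ρ * t ≤ ‖y t‖ := by
    refine ⟨6 / e * (2 / 3 * e * T₁ - inner ℝ (y T₁) (η T₁)), fun t ht1 ht => ?_⟩
    have h1 := hgrow t ht
    have h2 : inner ℝ (y t) (η t) ≤ ‖y t‖ * M :=
      (real_inner_le_norm _ _).trans (by gcongr; exact (hηM t ht).2)
    rw [div_mul_eq_mul_div, div_le_iff₀ he] at ht1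
    have h3 : e / 2 * t ≤ ‖y t‖ * M := by linarith
    rw [hρ, div_mul_eq_mul_div, div_le_iff₀ (by positivity)]
    linarith
  set T := max 1 (max T₁ T₂) with hT
  have hT1 : 1 ≤ T := le_max_left _ _
  have hTT₁ : T₁ ≤ T := (le_max_left _ _).trans (le_max_right _ _)
  have hTT₂ : T₂ ≤ T := (le_max_right _ _).trans (le_max_right _ _)
  set D := C * (ρ ^ (-μ) * M + ρ ^ (-1 - μ) * M ^ 2 + 16 * ρ ^ (1 - μ)) with hDdef
  have hD : 0 ≤ D := mul_nonneg h.nonneg (by positivity)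
  refine ⟨‖back 0 T (y T, η T)‖ + D / (μ - 1) * T ^ (1 - μ), m, M, T,
    Real.sqrt_pos.2 (by positivity), fun t ht => ⟨?_, ?_⟩⟩
  · have h1 := norm_sub_le_of_norm_deriv_le_rpow hμ hD (by linarith) ht hc.hasDerivAt_back
      (fun s hs => h.norm_backDeriv_le le_rfl zero_le_one (hT1.trans hs.1) (by norm_num) hρpos
        (hT₂ s (hTT₂.trans hs.1) (hTT₁.trans hs.1)) (hηM s (hTT₁.trans hs.1)).2)
    refine (norm_fst_le _).trans ?_
    have h2 := norm_sub_norm_le (back 0 t (y t, η t)) (back 0 T (y T, η T))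
    linarith
  · rw [back_zero]
    exact hηM t (hTT₁.trans ht)

theorem norm_back_sub_lt [FiniteDimensional ℝ E] (R T : ℝ) {δ : ℝ} (hδ : 0 < δ) :
    ∃ δ' > 0, ∀ ε, 0 ≤ ε → ε ≤ δ' → ∀ p q : E × E, ‖q‖ ≤ R → ‖p - q‖ < δ' →
      ‖back ε T p - back 0 T q‖ < δ := by
  have hK : IsCompact (Icc (0 : ℝ) 1 ×ˢ Metric.closedBall (0 : E × E) (R + 1)) :=
    isCompact_Icc.prod (isCompact_closedBall _ _)
  obtain ⟨δ', hδ', huc⟩ := Metric.uniformContinuousOn_iff.1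
    (hK.uniformContinuousOn_of_continuous (continuous_back (E := E) T).continuousOn) δ hδ
  refine ⟨min 1 (δ' / 2), by positivity, fun ε hε0 hε p q hq hpq => ?_⟩
  have hε1 := hε.trans (min_le_left _ _)
  have hε2 := hε.trans (min_le_right _ _)
  have hpq1 := hpq.le.trans (min_le_left _ _)
  have hpq2 := hpq.trans_le (min_le_right _ _)
  have hp : ‖p‖ ≤ R + 1 := by
    have := norm_sub_norm_le p q
    linarith
  rw [← dist_eq_norm]
  refine huc (ε, p) ⟨⟨hε0, hε1⟩, by simpa using hp⟩ (0, q)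
    ⟨⟨le_rfl, zero_le_one⟩, by simp only [Metric.mem_closedBall, dist_zero_right]; linarith⟩ ?_
  rw [Prod.dist_eq, dist_eq_norm, dist_eq_norm, sub_zero, Real.norm_of_nonneg hε0]
  exact max_lt (by linarith) (by linarith)

/-- Continuous dependence, on compact time intervals, of integral curves on the initial data and on
`ε` at `ε = 0`. -/
theorem ShortRange.exists_norm_sub_lt [FiniteDimensional ℝ E] (h : ShortRange μ C b g W)
    (R : ℝ) {T δ : ℝ} (hT : 0 ≤ T) (hδ : 0 < δ) :
    ∃ r > 0, ∃ ε₀ > 0, ∀ ε y η y' η', 0 ≤ ε → ε ≤ ε₀ → IsCurve b g W ε y η →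
      IsCurve b g W 0 y' η' → (∀ t ∈ Icc 0 T, ‖(y' t, η' t)‖ ≤ R) →
      ‖(y 0, η 0) - (y' 0, η' 0)‖ ≤ r →
      (∀ t ∈ Icc 0 T, ‖(y t, η t) - (y' t, η' t)‖ < δ) ∧
        ‖back ε T (y T, η T) - back 0 T (y' T, η' T)‖ < δ := by
  obtain ⟨δ', hδ', hback⟩ := norm_back_sub_lt (E := E) R T hδ
  set δ₁ := min (min 1 δ) δ' with hδ₁
  have hδ₁0 : 0 < δ₁ := by positivity
  have hδ₁1 : δ₁ ≤ 1 := (min_le_left _ _).trans (min_le_left _ _)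
  have hδ₁δ : δ₁ ≤ δ := (min_le_left _ _).trans (min_le_right _ _)
  have hδ₁δ' : δ₁ ≤ δ' := min_le_right _ _
  set S := Metric.closedBall (0 : E × E) (R + 1) with hS
  have hScomp : IsCompact S := isCompact_closedBall _ _
  set F : E × E → E × E := fun q => (b q.1 q.2, -g q.1 q.2) with hF
  obtain ⟨K, hK⟩ := (h.contDiff_b.prodMk h.contDiff_g.neg).contDiffOn.exists_lipschitzOnWith
    one_ne_zero (convex_closedBall (0 : E × E) (R + 1)) hScomp
  obtain ⟨B, hB⟩ := hScomp.exists_bound_of_continuousOn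
    (f := fun q : E × E => q.1 + W q.1)
    (continuous_fst.add (h.continuous_W.comp continuous_fst)).continuousOn
  set K' : NNReal := K + 1 with hK'
  have hK'1 : (1 : ℝ) ≤ K' := by simp [hK']
  have hFK' : LipschitzOnWith K' F S := hK.weaken (by simp [hK'])
  set L := exp (K' * T) with hL
  have hL0 : 0 < L := exp_pos _
  refine ⟨δ₁ / (4 * L), by positivity, min (min 1 δ₁) (δ₁ / (4 * L * (|B| + 1))), by positivity,
    fun ε y η y' η' hε0 hε hc hc' hR hinit => ?_⟩
  have hε1 : ε ≤ 1 := hε.trans ((min_le_left _ _).trans (min_le_left _ _))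
  have hεδ : ε ≤ δ₁ := hε.trans ((min_le_left _ _).trans (min_le_right _ _))
  have hεB : ε * (|B| + 1) * L ≤ δ₁ / 4 := by
    have := hε.trans (min_le_right _ _)
    rw [le_div_iff₀ (by positivity)] at this
    linarith
  have hclose : ∀ t ∈ Icc 0 T, ‖(y t, η t) - (y' t, η' t)‖ < δ₁ := by
    refine lt_of_forall_Ico_lt (hc.continuous.sub hc'.continuous).norm.continuousOn ?_
    intro t ht hlt
    have hmem' : ∀ s ∈ Ico 0 t, (y' s, η' s) ∈ S := fun s hs => by
      have := hR s ⟨hs.1, hs.2.le.trans ht.2⟩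
      simp only [hS, Metric.mem_closedBall, dist_zero_right]
      linarith
    have hmem : ∀ s ∈ Ico 0 t, (y s, η s) ∈ S := fun s hs => by
      have h1 := hR s ⟨hs.1, hs.2.le.trans ht.2⟩
      have h2 := hlt s hs
      have h3 := norm_sub_norm_le (y s, η s) (y' s, η' s)
      simp only [hS, Metric.mem_closedBall, dist_zero_right]
      linarith
    have key := dist_le_of_approx_trajectories_ODE_of_mem (v := fun _ => F) (s := fun _ => S)
      (K := K') (a := 0) (b := t) (f := fun s => (y s, η s)) (g := fun s => (y' s, η' s))
      (f' := fun s => (b (y s) (η s), -(g (y s) (η s) + ε ^ 2 • (y s + W (y s)))))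
      (g' := fun s => F (y' s, η' s)) (εf := ε * |B|) (εg := 0) (δ := δ₁ / (4 * L))
      (fun _ _ => hFK') hc.continuous.continuousOn
      (fun s _ => ((hc.deriv_fst s).prodMk (hc.deriv_snd s)).hasDerivWithinAt)
      (fun s hs => ?_) hmem hc'.continuous.continuousOn
      (fun s _ => by
        have := ((hc'.deriv_fst s).prodMk (hc'.deriv_snd s)).hasDerivWithinAt (s := Ici s)
        simpa [hF] using this)
      (fun s _ => by simp) hmem' (by rw [dist_eq_norm]; exact hinit) t (right_mem_Icc.2 ht.1)
    · rw [dist_eq_norm, gronwallBound_of_K_ne_0 (by positivity), add_zero, sub_zero] at key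
      refine key.trans_lt ?_
      have hLt : exp (K' * t) ≤ L := exp_le_exp.2 (by gcongr; exact ht.2)
      have h1 : δ₁ / (4 * L) * exp (K' * t) ≤ δ₁ / 4 := by
        calc _ ≤ δ₁ / (4 * L) * L := by gcongr
          _ = δ₁ / 4 := by field_simp
      have h2 : ε * |B| / K' * (exp (K' * t) - 1) ≤ ε * (|B| + 1) * L := by
        have : 0 ≤ exp (K' * t) - 1 := by
          have := one_le_exp (show 0 ≤ K' * t by have := ht.1; positivity)
          linarith
        refine mul_le_mul ((div_le_self (by positivity) hK'1).trans (by gcongr; linarith))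
          (by linarith) this (by positivity)
      linarith
    · rw [dist_eq_norm]
      have hb := hB _ (hmem s hs)
      have : (b (y s) (η s), -(g (y s) (η s) + ε ^ 2 • (y s + W (y s)))) - F (y s, η s) =
          (0, -(ε ^ 2 • (y s + W (y s)))) := by
        simp only [hF, Prod.mk_sub_mk, sub_self]
        congr 1
        abel
      rw [this, Prod.norm_mk, norm_zero, norm_neg, norm_smul, Real.norm_of_nonneg (sq_nonneg ε)]
      refine max_le (by positivity) ?_
      refine mul_le_mul (by nlinarith) (hb.trans (le_abs_self B)) (norm_nonneg _) hε0
  refine ⟨fun t ht => (hclose t ht).trans_le hδ₁δ, hback ε hε0 (hεδ.trans hδ₁δ') _ _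
    (hR T (right_mem_Icc.2 hT)) ((hclose T (right_mem_Icc.2 hT)).trans_le hδ₁δ')⟩

/-- Uniform dispersion: integral curves starting near a nontrapped geodesic stay in a
neighbourhood of its free asymptotics, up to the time `σ / ε`. -/
theorem ShortRange.exists_uniform_bounds [FiniteDimensional ℝ E] (h : ShortRange μ C b g W)
    {y₀ η₀ : ℝ → E} (hc₀ : IsCurve b g W 0 y₀ η₀) {e : ℝ} (he : 0 < e)
    (hen : ∀ t, inner ℝ (b (y₀ t) (η₀ t)) (η₀ t) = e)
    (hnt : Tendsto (fun t => ‖y₀ t‖) atTop atTop) {σ : ℝ} (hσ : 0 < σ) (hσπ : σ < π) :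
    ∃ r > 0, ∃ ε₀ > 0, ∃ T₀ > 0, ∃ D N : ℝ, 0 ≤ D ∧ ∀ ε y η, 0 ≤ ε → ε ≤ ε₀ →
      IsCurve b g W ε y η → ‖(y 0, η 0) - (y₀ 0, η₀ 0)‖ ≤ r →
      (∀ t ∈ Icc 0 T₀, ‖(y t, η t)‖ ≤ N) ∧
      (∀ t, T₀ ≤ t → ε * t ≤ σ → ‖back ε t (y t, η t)‖ ≤ N) ∧
      (∀ T t, T₀ ≤ T → T ≤ t → ε * t ≤ σ →
        ‖back ε t (y t, η t) - back ε T (y T, η T)‖ ≤ D / (μ - 1) * T ^ (1 - μ)) := by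
  obtain ⟨Z, m, M, T₁, hm, hbd⟩ := h.exists_bounds_of_tendsto hc₀ he hen hnt
  have hμ := h.one_lt
  have hZ : 0 ≤ Z := (norm_nonneg _).trans (hbd T₁ le_rfl).1
  have hmM : m ≤ M := (hbd T₁ le_rfl).2.1.trans (hbd T₁ le_rfl).2.2
  set κ := sinc σ with hκdef
  have hκ : 0 < κ := sinc_pos hσ hσπ
  set δ := min 1 (m / 2) with hδdef
  have hδ : 0 < δ := by positivity
  have hδ1 : δ ≤ 1 := min_le_left _ _
  have hδm : δ ≤ m / 2 := min_le_right _ _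
  set ρ := κ * m / 4 with hρdef
  have hρ : 0 < ρ := by positivity
  set P := M + Z + 2 with hP
  set D := C * (ρ ^ (-μ) * P + ρ ^ (-1 - μ) * P ^ 2 + 16 * ρ ^ (1 - μ)) with hDdef
  have hP0 : 0 ≤ P := by linarith
  have hD : 0 ≤ D := mul_nonneg h.nonneg (by positivity)
  obtain ⟨T₀, hG, hT₀1, hT₀T₁, hT₀Z⟩ : ∃ T₀ : ℝ, D / (μ - 1) * T₀ ^ (1 - μ) < δ / 2 ∧ 1 ≤ T₀ ∧
      T₁ ≤ T₀ ∧ (Z + 1) / ρ ≤ T₀ :=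
    (((tendsto_mul_rpow_one_sub hμ D).eventually_lt_const (half_pos hδ)).and
      ((eventually_ge_atTop 1).and ((eventually_ge_atTop T₁).and (eventually_ge_atTop _)))).exists
  have hT₀ : 0 < T₀ := by linarith
  obtain ⟨R, hR⟩ := (isCompact_Icc (a := (0 : ℝ)) (b := T₀)).exists_bound_of_continuousOn
    hc₀.continuous.continuousOn
  obtain ⟨r, hr, ε₁, hε₁, hdep⟩ := h.exists_norm_sub_lt R hT₀.le (half_pos hδ)
  set w := back 0 T₀ (y₀ T₀, η₀ T₀) with hw
  obtain ⟨hw1, hw2, hw3⟩ := hbd T₀ hT₀T₁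
  refine ⟨r, hr, min 1 ε₁, by positivity, T₀, hT₀, D, max (R + 1) (‖w‖ + 1), hD,
    fun ε y η hε0 hε hc hinit => ?_⟩
  have hε1 : ε ≤ 1 := hε.trans (min_le_left _ _)
  obtain ⟨hcl, hclT⟩ := hdep ε y η y₀ η₀ hε0 (hε.trans (min_le_right _ _)) hc hc₀ hR hinit
  have hder : ∀ t, T₀ ≤ t → ε * t ≤ σ → ‖back ε t (y t, η t) - w‖ < δ →
      ‖backDeriv b g W ε t (y t) (η t)‖ ≤ D * t ^ (-μ) := by
    intro t ht hεt hlt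
    have ht0 : 0 ≤ t := hT₀.le.trans ht
    have hz := (norm_fst_le _).trans_lt hlt
    have hζ := (norm_snd_le _).trans_lt hlt
    have hz1 := norm_sub_norm_le (back ε t (y t, η t)).1 w.1
    have hζ1 := norm_sub_norm_le (back ε t (y t, η t)).2 w.2
    have hζ2 := norm_sub_norm_le w.2 (back ε t (y t, η t)).2
    rw [norm_sub_rev w.2] at hζ2
    simp only [Prod.fst_sub, Prod.snd_sub] at hz hζ
    have hzZ : ‖(back ε t (y t, η t)).1‖ ≤ Z + 1 := by linarith
    have hζM : ‖(back ε t (y t, η t)).2‖ ≤ M + 1 := by linarith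
    have hζm : m / 2 ≤ ‖(back ε t (y t, η t)).2‖ := by linarith
    have hs := sinc_mul_le_sine hε0 ht0 hσ hσπ hεt
    have hs0 : 0 ≤ sine ε t := (mul_nonneg hκ.le ht0).trans hs
    refine h.norm_backDeriv_le hε0 hε1 (hT₀1.trans ht) ?_ hρ ?_ ?_
    · exact hεt.trans (hσπ.le.trans pi_le_four)
    · have h1 := fst_eq_of_back ε t (y t, η t)
      have h2 : ‖sine ε t • (back ε t (y t, η t)).2‖ ≤
          ‖y t‖ + ‖cos (ε * t) • (back ε t (y t, η t)).1‖ := by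
        have : sine ε t • (back ε t (y t, η t)).2 =
            y t - cos (ε * t) • (back ε t (y t, η t)).1 := by
          rw [eq_sub_iff_add_eq', ← h1]
        rw [this]
        exact norm_sub_le _ _
      rw [norm_smul, norm_smul, Real.norm_of_nonneg hs0] at h2
      have h3 : ‖cos (ε * t)‖ * ‖(back ε t (y t, η t)).1‖ ≤ Z + 1 :=
        (mul_le_of_le_one_left (norm_nonneg _) (abs_cos_le_one _)).trans hzZ
      have h4 : κ * t * (m / 2) ≤ sine ε t * ‖(back ε t (y t, η t)).2‖ := by gcongr
      have h5 : Z + 1 ≤ ρ * t := by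
        have := hT₀Z.trans ht
        rw [div_le_iff₀ hρ] at this
        linarith
      have h6 : κ * t * (m / 2) = 2 * (ρ * t) := by rw [hρdef]; ring
      linarith
    · have h1 := snd_eq_of_back ε t (y t, η t)
      simp only at h1
      rw [h1]
      refine (norm_sub_le _ _).trans ?_
      rw [norm_smul, norm_smul]
      have h2 : ‖cos (ε * t)‖ * ‖(back ε t (y t, η t)).2‖ ≤ M + 1 :=
        (mul_le_of_le_one_left (norm_nonneg _) (abs_cos_le_one _)).trans hζM
      have h3 : ‖ε ^ 2 * sine ε t‖ * ‖(back ε t (y t, η t)).1‖ ≤ Z + 1 :=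
        (mul_le_of_le_one_left (norm_nonneg _) ((abs_sq_mul_sine_le hε0 t).trans hε1)).trans hzZ
      linarith
  have hnear : ∀ t, T₀ ≤ t → ε * t ≤ σ → ‖back ε t (y t, η t) - w‖ < δ := by
    intro t ht hεt
    refine lt_of_forall_Ico_lt (a := T₀) (b := t)
      (f := fun s => ‖back ε s (y s, η s) - w‖) ?_ (fun s hs hlt => ?_) t (right_mem_Icc.2 ht)
    · exact fun s _ =>
        ((hc.hasDerivAt_back s).continuousAt.sub continuousAt_const).norm.continuousWithinAt
    · have h1 := norm_sub_le_of_norm_deriv_le_rpow hμ hD hT₀ hs.1 hc.hasDerivAt_back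
        (fun s' hs' => hder s' hs'.1
          ((mul_le_mul_of_nonneg_left (hs'.2.le.trans hs.2) hε0).trans hεt) (hlt s' hs'))
      have h2 := norm_sub_le_norm_sub_add_norm_sub (back ε s (y s, η s))
        (back ε T₀ (y T₀, η T₀)) w
      linarith
  refine ⟨fun t ht => ?_, fun t ht hεt => ?_, fun T t hT hTt hεt => ?_⟩
  · have h1 := norm_sub_norm_le (y t, η t) (y₀ t, η₀ t)
    have h2 := hcl t ht
    have h3 := hR t ht
    exact le_max_of_le_left (by linarith)
  · have h1 := norm_sub_norm_le (back ε t (y t, η t)) w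
    have h2 := hnear t ht hεt
    exact le_max_of_le_right (by linarith)
  · exact norm_sub_le_of_norm_deriv_le_rpow hμ hD (hT₀.trans_le hT) hTt hc.hasDerivAt_back
      (fun s hs => by
        have hεs := (mul_le_mul_of_nonneg_left hs.2.le hε0).trans hεt
        exact hder s (hT.trans hs.1) hεs (hnear s (hT.trans hs.1) hεs))

/-- Near a nontrapped geodesic the wave map of the geodesic flow exists, and it is the uniform
limit of the comparison of the perturbed and the free harmonic oscillators at time `σ / ε`. -/
theorem ShortRange.exists_wave_map [FiniteDimensional ℝ E] (h : ShortRange μ C b g W)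
    {y₀ η₀ : ℝ → E} (hc₀ : IsCurve b g W 0 y₀ η₀) {e : ℝ} (he : 0 < e)
    (hen : ∀ t, inner ℝ (b (y₀ t) (η₀ t)) (η₀ t) = e)
    (hnt : Tendsto (fun t => ‖y₀ t‖) atTop atTop) {σ : ℝ} (hσ : 0 < σ) (hσπ : σ < π) :
    ∃ r > 0,
      (∀ y η, IsCurve b g W 0 y η → ‖(y 0, η 0) - (y₀ 0, η₀ 0)‖ ≤ r →
        ∃ w, Tendsto (fun t => back 0 t (y t, η t)) atTop (𝓝 w)) ∧
      ∀ δ > 0, ∃ ε₁ > 0, ∀ ε y η y' η' w, 0 < ε → ε ≤ ε₁ → IsCurve b g W ε y η →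
        IsCurve b g W 0 y' η' → (y 0, η 0) = (y' 0, η' 0) →
        ‖(y 0, η 0) - (y₀ 0, η₀ 0)‖ ≤ r →
        Tendsto (fun t => back 0 t (y' t, η' t)) atTop (𝓝 w) →
        ‖back ε (σ / ε) (y (σ / ε), η (σ / ε)) - w‖ < δ := by
  obtain ⟨r, hr, ε₀, hε₀, T₀, hT₀, D, N, hD, hunif⟩ :=
    h.exists_uniform_bounds hc₀ he hen hnt hσ hσπ
  have hμ := h.one_lt
  refine ⟨r, hr, fun y η hc hinit => ?_, fun δ hδ => ?_⟩
  · obtain ⟨-, -, h3⟩ := hunif 0 y η le_rfl hε₀.le hc hinit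
    refine cauchySeq_tendsto_of_complete (Metric.cauchySeq_iff'.2 fun δ hδ => ?_)
    obtain ⟨T, hT, hTT₀⟩ := (((tendsto_mul_rpow_one_sub hμ D).eventually_lt_const hδ).and
      (eventually_ge_atTop T₀)).exists
    refine ⟨T, fun t ht => ?_⟩
    rw [dist_eq_norm]
    exact (h3 T t hTT₀ ht (by simpa using hσ.le)).trans_lt hT
  · obtain ⟨T, hT, hTT₀⟩ := (((tendsto_mul_rpow_one_sub hμ D).eventually_lt_const
      (show 0 < δ / 3 by positivity)).and (eventually_ge_atTop T₀)).exists
    have hT0 : 0 < T := hT₀.trans_le hTT₀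
    obtain ⟨r', hr', ε₁, hε₁, hdep⟩ := h.exists_norm_sub_lt (N + (1 + T) * N) hT0.le
      (show 0 < δ / 3 by positivity)
    refine ⟨min (min ε₀ ε₁) (σ / T), by positivity,
      fun ε y η y' η' w hε hεle hc hc' hinit hinit₀ hw => ?_⟩
    have hεε₀ : ε ≤ ε₀ := hεle.trans ((min_le_left _ _).trans (min_le_left _ _))
    have hεε₁ : ε ≤ ε₁ := hεle.trans ((min_le_left _ _).trans (min_le_right _ _))
    have hTσ : T ≤ σ / ε := by
      have := hεle.trans (min_le_right _ _)
      rw [le_div_iff₀ hT0] at this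
      rw [le_div_iff₀ hε]
      linarith
    obtain ⟨-, -, h3⟩ := hunif ε y η hε.le hεε₀ hc hinit₀
    obtain ⟨h1', h2', h3'⟩ := hunif 0 y' η' le_rfl hε₀.le hc' (hinit ▸ hinit₀)
    have hN : 0 ≤ N := (norm_nonneg _).trans (h1' 0 (left_mem_Icc.2 hT₀.le))
    have hbdd : ∀ t ∈ Icc 0 T, ‖(y' t, η' t)‖ ≤ N + (1 + T) * N := by
      intro t ht
      rcases le_total t T₀ with htT₀ | htT₀
      · have := h1' t ⟨ht.1, htT₀⟩
        have : 0 ≤ (1 + T) * N := by positivity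
        linarith
      · have hb := h2' t htT₀ (by simpa using hσ.le)
        have hz := (norm_fst_le _).trans hb
        have hζ := (norm_snd_le _).trans hb
        have e1 : y' t = (back 0 t (y' t, η' t)).1 + t • (back 0 t (y' t, η' t)).2 := by
          simp [back_zero]
        have e2 : η' t = (back 0 t (y' t, η' t)).2 := by simp [back_zero]
        have hTN : 0 ≤ T * N := by positivity
        refine max_le ?_ ?_
        · change ‖y' t‖ ≤ _
          rw [e1]
          refine (norm_add_le _ _).trans ?_
          rw [norm_smul, Real.norm_of_nonneg ht.1]
          have : t * ‖(back 0 t (y' t, η' t)).2‖ ≤ T * N :=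
            mul_le_mul ht.2 hζ (norm_nonneg _) hT0.le
          linarith
        · change ‖η' t‖ ≤ _
          rw [e2]
          linarith
    have a1 := h3 T (σ / ε) hTT₀ hTσ (mul_div_cancel₀ _ hε.ne').le
    have a2 := (hdep ε y η y' η' hε.le hεε₁ hc hc' hbdd (by simpa [hinit] using hr'.le)).2
    have a3 : ‖w - back 0 T (y' T, η' T)‖ ≤ D / (μ - 1) * T ^ (1 - μ) :=
      le_of_tendsto (hw.sub_const _).norm ((eventually_ge_atTop T).mono fun t ht =>
        h3' T t hTT₀ ht (by simpa using hσ.le))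
    rw [norm_sub_rev] at a3
    have b1 := norm_sub_le_norm_sub_add_norm_sub (back ε (σ / ε) (y (σ / ε), η (σ / ε)))
      (back ε T (y T, η T)) w
    have b2 := norm_sub_le_norm_sub_add_norm_sub (back ε T (y T, η T))
      (back 0 T (y' T, η' T)) w
    linarith

end Perturbation

section Concrete

variable {n : ℕ}

theorem norm_le_sum_abs (v : En n) : ‖v‖ ≤ ∑ j, |v j| := by
  have h : v = ∑ j, EuclideanSpace.single j (v j) := by
    ext i
    simp [Finset.sum_apply, Pi.single_apply]
  calc ‖v‖ = ‖∑ j, EuclideanSpace.single j (v j)‖ := by rw [← h]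
    _ ≤ ∑ j, ‖EuclideanSpace.single j (v j)‖ := norm_sum_le _ _
    _ = ∑ j, |v j| := by simp

theorem abs_coord_le (v : En n) (j : Fin n) : |v j| ≤ ‖v‖ := by
  simpa using PiLp.norm_apply_le v j

theorem hasDerivAt_of_coord {f : ℝ → En n} {f' : En n} {t : ℝ}
    (h : ∀ j, HasDerivAt (fun s => f s j) (f' j) t) : HasDerivAt f f' t := by
  rw [hasDerivAt_iff_hasFDerivAt, ← hasFDerivWithinAt_univ, hasFDerivWithinAt_euclidean]
  intro j
  rw [hasFDerivWithinAt_univ]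
  refine (h j).hasFDerivAt.congr_fderiv ?_
  ext
  simp

theorem abs_pd_le (f : En n → ℝ) (j : Fin n) (x : En n) : |pd f j x| ≤ ‖fderiv ℝ f x‖ := by
  have := (fderiv ℝ f x).le_opNorm (EuclideanSpace.single j 1)
  simpa [pd] using this

theorem jb_rpow_le {x : En n} {r s : ℝ} (hr : 0 < r) (hrx : r ≤ ‖x‖) (hs : s ≤ 0) :
    jb x ^ s ≤ r ^ s :=
  Real.rpow_le_rpow_of_nonpos hr
    (hrx.trans (Real.le_sqrt_of_sq_le (by linarith [sq_nonneg ‖x‖]))) hs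

theorem contDiff_pd {f : En n → ℝ} (hf : ContDiff ℝ (⊤ : ℕ∞) f) (j : Fin n) :
    ContDiff ℝ 1 (pd f j) :=
  (hf.fderiv_right (m := 1) (by norm_cast)).clm_apply contDiff_const

/-- The velocity `∂k/∂ξ`. -/
noncomputable def velocity (a : Fin n → Fin n → En n → ℝ) (x ξ : En n) : En n :=
  WithLp.toLp 2 fun j => ∑ i, a j i x * ξ i

/-- The gradient `∂k/∂x`. -/
noncomputable def gradKinetic (a : Fin n → Fin n → En n → ℝ) (x ξ : En n) : En n :=
  WithLp.toLp 2 fun j => (1 / 2) * ∑ i, ∑ l, pd (a i l) j x * ξ i * ξ l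

/-- The gradient of the potential. -/
noncomputable def gradPotential (V : En n → ℝ) (x : En n) : En n :=
  WithLp.toLp 2 fun j => pd V j x

theorem velocity_smul (a : Fin n → Fin n → En n → ℝ) (x ξ : En n) (c : ℝ) :
    velocity a x (c • ξ) = c • velocity a x ξ := by
  ext j
  simp only [velocity, PiLp.smul_apply, smul_eq_mul, Finset.mul_sum]
  exact Finset.sum_congr rfl fun i _ => by ring

theorem gradKinetic_smul (a : Fin n → Fin n → En n → ℝ) (x ξ : En n) (c : ℝ) :
    gradKinetic a x (c • ξ) = c ^ 2 • gradKinetic a x ξ := by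
  ext j
  simp only [gradKinetic, PiLp.smul_apply, smul_eq_mul, Finset.mul_sum]
  exact Finset.sum_congr rfl fun i _ => Finset.sum_congr rfl fun l _ => by ring

theorem inner_velocity (a : Fin n → Fin n → En n → ℝ) (x ξ : En n) :
    inner ℝ (velocity a x ξ) ξ = ∑ j, ∑ k, a j k x * ξ j * ξ k := by
  simp only [velocity, PiLp.inner_apply, RCLike.inner_apply, conj_trivial, Finset.mul_sum]
  exact Finset.sum_congr rfl fun i _ => Finset.sum_congr rfl fun l _ => by ring

variable {a : Fin n → Fin n → En n → ℝ} {V : En n → ℝ} {μ : ℝ}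

theorem exists_shortRange (hA : AssumptionA n a V μ) :
    ∃ C, ShortRange μ C (velocity a) (gradKinetic a) (gradPotential V) := by
  have hμ := hA.one_lt_mu
  choose C₀ hC₀ hdec₀ using hA.decay_a 0
  choose C₁ hC₁ hdec₁ using hA.decay_a 1
  obtain ⟨C₂, hC₂, hdec₂⟩ := hA.decay_V 1
  have h₀ : 0 ≤ ∑ j, ∑ k, C₀ j k :=
    Finset.sum_nonneg fun j _ => Finset.sum_nonneg fun k _ => (hC₀ j k).le
  have h₁ : 0 ≤ n * ∑ j, ∑ k, C₁ j k :=
    mul_nonneg n.cast_nonneg <|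
      Finset.sum_nonneg fun j _ => Finset.sum_nonneg fun k _ => (hC₁ j k).le
  have h₂ : 0 ≤ n * C₂ := mul_nonneg n.cast_nonneg hC₂.le
  refine ⟨∑ j, ∑ k, C₀ j k + n * ∑ j, ∑ k, C₁ j k + n * C₂, hμ, by positivity, ?_, ?_, ?_, ?_,
    ?_, ?_⟩
  · refine contDiff_euclidean.2 fun j => ?_
    change ContDiff ℝ 1 fun q : En n × En n => ∑ i, a j i q.1 * q.2 i
    refine ContDiff.sum fun i _ => ?_
    have := (hA.smooth_a j i).of_le (m := 1) (by norm_cast)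
    exact (this.comp contDiff_fst).mul ((contDiff_euclidean.1 contDiff_id i).comp contDiff_snd)
  · refine contDiff_euclidean.2 fun j => contDiff_const.mul <|
      ContDiff.sum fun i _ => ContDiff.sum fun l _ => ?_
    have := contDiff_pd (hA.smooth_a i l) j
    exact ((this.comp contDiff_fst).mul
      ((contDiff_euclidean.1 contDiff_id i).comp contDiff_snd)).mul
        ((contDiff_euclidean.1 contDiff_id l).comp contDiff_snd)
  · exact (contDiff_euclidean.2 fun j => contDiff_pd hA.smooth_V j :
      ContDiff ℝ 1 (gradPotential V)).continuous
  · intro y η r hr hry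
    have hcoord : ∀ j, (velocity a y η - η) j = ∑ i, (a j i y - kdelta j i) * η i := fun j => by
      simp [velocity, kdelta, sub_mul, Finset.sum_sub_distrib]
    have hbound : ∀ j i, |a j i y - kdelta j i| ≤ C₀ j i * r ^ (-μ) := fun j i => by
      have := hdec₀ j i y
      rw [norm_iteratedFDeriv_zero, Real.norm_eq_abs, Nat.cast_zero, sub_zero] at this
      exact this.trans (mul_le_mul_of_nonneg_left (jb_rpow_le hr hry (by linarith)) (hC₀ j i).le)
    calc ‖velocity a y η - η‖ ≤ ∑ j, |(velocity a y η - η) j| := norm_le_sum_abs _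
      _ ≤ ∑ j, ∑ i, C₀ j i * r ^ (-μ) * ‖η‖ := by
        refine Finset.sum_le_sum fun j _ => ?_
        rw [hcoord]
        refine (Finset.abs_sum_le_sum_abs _ _).trans (Finset.sum_le_sum fun i _ => ?_)
        rw [abs_mul]
        exact mul_le_mul (hbound j i) (abs_coord_le η i) (abs_nonneg _)
          (mul_nonneg (hC₀ j i).le (by positivity))
      _ = (∑ j, ∑ i, C₀ j i) * r ^ (-μ) * ‖η‖ := by simp only [Finset.sum_mul]
      _ ≤ _ := by gcongr; linarith
  · intro y η r hr hry
    have hbound : ∀ j i l, |pd (a i l) j y| ≤ C₁ i l * r ^ (-1 - μ) := fun j i l => by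
      have := hdec₁ i l y
      rw [norm_iteratedFDeriv_one, fderiv_sub_const, Nat.cast_one,
        show -μ - 1 = -1 - μ by ring] at this
      exact (abs_pd_le _ _ _).trans <| this.trans
        (mul_le_mul_of_nonneg_left (jb_rpow_le hr hry (by linarith)) (hC₁ i l).le)
    calc ‖gradKinetic a y η‖ ≤ ∑ j, |gradKinetic a y η j| := norm_le_sum_abs _
      _ ≤ ∑ _j : Fin n, ∑ i, ∑ l, C₁ i l * r ^ (-1 - μ) * ‖η‖ ^ 2 := by
        refine Finset.sum_le_sum fun j _ => ?_
        simp only [gradKinetic]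
        rw [abs_mul]
        refine (mul_le_of_le_one_left (abs_nonneg _) (by norm_num [abs_of_pos])).trans ?_
        refine (Finset.abs_sum_le_sum_abs _ _).trans (Finset.sum_le_sum fun i _ => ?_)
        refine (Finset.abs_sum_le_sum_abs _ _).trans (Finset.sum_le_sum fun l _ => ?_)
        rw [abs_mul, abs_mul, mul_assoc, sq]
        exact mul_le_mul (hbound j i l)
          (mul_le_mul (abs_coord_le η i) (abs_coord_le η l) (abs_nonneg _) (norm_nonneg _))
          (by positivity) (mul_nonneg (hC₁ i l).le (by positivity))
      _ = (n * ∑ i, ∑ l, C₁ i l) * r ^ (-1 - μ) * ‖η‖ ^ 2 := by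
        simp only [← Finset.sum_mul, Finset.sum_const, Finset.card_univ, Fintype.card_fin,
          nsmul_eq_mul]
      _ ≤ _ := by gcongr; linarith
  · intro y r hr hry
    have hbound : ∀ j, |pd V j y| ≤ C₂ * r ^ (1 - μ) := fun j => by
      have := hdec₂ y
      rw [norm_iteratedFDeriv_one, Nat.cast_one, show 2 - μ - 1 = 1 - μ by ring] at this
      exact (abs_pd_le _ _ _).trans <| this.trans
        (mul_le_mul_of_nonneg_left (jb_rpow_le hr hry (by linarith)) hC₂.le)
    calc ‖gradPotential V y‖ ≤ ∑ j, |gradPotential V y j| := norm_le_sum_abs _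
      _ ≤ ∑ _j : Fin n, C₂ * r ^ (1 - μ) := Finset.sum_le_sum fun j _ => hbound j
      _ = n * C₂ * r ^ (1 - μ) := by simp [mul_assoc]
      _ ≤ _ := by gcongr; linarith

theorem isCurve_of_isFlowK {y η : ℝ → En n} (h : IsFlowK a y η) :
    IsCurve (velocity a) (gradKinetic a) (gradPotential V) 0 y η :=
  ⟨fun t => hasDerivAt_of_coord fun j => h.1 t j,
    fun t => hasDerivAt_of_coord fun j => (h.2 t j).congr_deriv (by simp [gradKinetic])⟩

theorem isCurve_of_isFlowP {y η : ℝ → En n} (h : IsFlowP a V y η) (lam : ℝ) :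
    IsCurve (velocity a) (gradKinetic a) (gradPotential V) lam⁻¹
      (fun t => y (lam⁻¹ * t)) (fun t => lam⁻¹ • η (lam⁻¹ * t)) := by
  have hscale : ∀ t, HasDerivAt (fun t => lam⁻¹ * t) lam⁻¹ t := fun t => by
    simpa using (hasDerivAt_id' t).const_mul lam⁻¹
  have hy : ∀ t, HasDerivAt y (velocity a (y t) (η t)) t := fun t =>
    hasDerivAt_of_coord fun j => h.1 t j
  have hη : ∀ t, HasDerivAt η
      (-(gradKinetic a (y t) (η t) + y t + gradPotential V (y t))) t := fun t =>
    hasDerivAt_of_coord fun j => (h.2 t j).congr_deriv (by simp [gradKinetic, gradPotential])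
  refine ⟨fun t => ?_, fun t => ?_⟩
  · rw [velocity_smul]
    exact (hy _).scomp t (hscale t)
  · rw [gradKinetic_smul]
    refine (((hη _).scomp t (hscale t)).const_smul lam⁻¹).congr_deriv ?_
    module

theorem hasDerivAt_comp_pd {f : En n → ℝ} (hf : ContDiff ℝ (⊤ : ℕ∞) f) {y : ℝ → En n}
    {y' : En n} {t : ℝ} (hy : HasDerivAt y y' t) :
    HasDerivAt (fun s => f (y s)) (∑ j, pd f j (y t) * y' j) t := by
  have hd := (hf.differentiable (by simp) (y t)).hasFDerivAt.comp_hasDerivAt t hy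
  refine hd.congr_deriv ?_
  have h : y' = ∑ j, y' j • EuclideanSpace.single j (1 : ℝ) := by
    ext i
    simp [Finset.sum_apply, Pi.single_apply]
  conv_lhs => rw [h]
  simp only [map_sum, map_smul, smul_eq_mul, pd]
  exact Finset.sum_congr rfl fun j _ => mul_comm _ _

theorem kinetic_conserved (hA : AssumptionA n a V μ) {y η : ℝ → En n} (h : IsFlowK a y η)
    (t : ℝ) : inner ℝ (velocity a (y t) (η t)) (η t) =
      inner ℝ (velocity a (y 0) (η 0)) (η 0) := by
  have hc : IsCurve (velocity a) (gradKinetic a) (gradPotential V) 0 y η := isCurve_of_isFlowK h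
  have hder : ∀ t, HasDerivAt (fun s => ∑ j, ∑ k, a j k (y s) * η s j * η s k) 0 t := by
    intro t
    have hterm : ∀ j k, HasDerivAt (fun s => a j k (y s) * η s j * η s k)
        (((∑ i, pd (a j k) i (y t) * velocity a (y t) (η t) i) * η t j +
            a j k (y t) * -gradKinetic a (y t) (η t) j) * η t k +
          a j k (y t) * η t j * -gradKinetic a (y t) (η t) k) t := fun j k =>
      ((hasDerivAt_comp_pd (hA.smooth_a j k) (hc.deriv_fst t)).mul (h.2 t j)).mul (h.2 t k)
    refine (HasDerivAt.fun_sum fun j _ => HasDerivAt.fun_sum fun k _ => hterm j k).congr_deriv ?_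
    set v := velocity a (y t) (η t) with hv
    set G := gradKinetic a (y t) (η t) with hG
    have e1 : ∑ j, ∑ k, (∑ i, pd (a j k) i (y t) * v i) * η t j * η t k =
        2 * ∑ i, v i * G i := by
      simp only [hG, gradKinetic, Finset.mul_sum, Finset.sum_mul]
      rw [Finset.sum_comm_cycle]
      exact Finset.sum_congr rfl fun i _ => Finset.sum_congr rfl fun j _ =>
        Finset.sum_congr rfl fun k _ => by ring
    have e2 : ∑ j, ∑ k, a j k (y t) * G j * η t k = ∑ i, v i * G i := by
      simp only [hv, velocity, Finset.sum_mul]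
      exact Finset.sum_congr rfl fun j _ => Finset.sum_congr rfl fun k _ => by ring
    have e3 : ∑ j, ∑ k, a j k (y t) * η t j * G k = ∑ i, v i * G i := by
      rw [Finset.sum_comm]
      simp only [hv, velocity, Finset.sum_mul]
      exact Finset.sum_congr rfl fun j _ => Finset.sum_congr rfl fun k _ => by
        rw [hA.symm k j]
    have e4 : ∑ j, ∑ k, (((∑ i, pd (a j k) i (y t) * v i) * η t j + a j k (y t) * -G j) * η t k +
        a j k (y t) * η t j * -G k) =
        ∑ j, ∑ k, (∑ i, pd (a j k) i (y t) * v i) * η t j * η t k -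
          ∑ j, ∑ k, a j k (y t) * G j * η t k - ∑ j, ∑ k, a j k (y t) * η t j * G k := by
      simp only [← Finset.sum_sub_distrib]
      exact Finset.sum_congr rfl fun j _ => Finset.sum_congr rfl fun k _ => by ring
    rw [e4, e1, e2, e3]
    ring
  rw [inner_velocity, inner_velocity]
  exact is_const_of_deriv_eq_zero (fun t => (hder t).differentiableAt)
    (fun t => (hder t).deriv) t 0

theorem kinetic_pos_of_tendsto (hA : AssumptionA n a V μ) {y η : ℝ → En n} (h : IsFlowK a y η)
    (hnt : Tendsto (fun t => ‖y t‖) atTop atTop) :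
    0 < inner ℝ (velocity a (y 0) (η 0)) (η 0) := by
  have hc : IsCurve (velocity a) (gradKinetic a) (gradPotential V) 0 y η := isCurve_of_isFlowK h
  by_contra hcon
  have hη : ∀ t, η t = 0 := fun t => by
    by_contra hne
    have := hA.posdef (y t) (η t) hne
    rw [← inner_velocity, kinetic_conserved hA h t] at this
    exact hcon this
  have hconst : ∀ t, y t = y 0 := fun t =>
    is_const_of_deriv_eq_zero (fun t => (hc.deriv_fst t).differentiableAt)
      (fun t => (hc.deriv_fst t).deriv.trans (by rw [hη]; ext; simp [velocity])) t 0
  simp only [hconst] at hnt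
  exact not_tendsto_const_atTop _ _ hnt

end Concrete

end HarmonicScattering

/-- Theorem 2.4 (i). Under Assumption A, if `(x₀,ξ₀)` is forward
nontrapping for `k` and `0 < σ < π`, there is a neighborhood `Ω` of `(x₀,ξ₀)` on which the
classical wave operator `S₊` exists and, uniformly for `(x,ξ) ∈ Ω`,
`π₁(exp(−σH_{p₀}) ∘ exp(σH_p)(x,λξ)) → π₁(S₊(x,ξ))` and
`λ⁻¹ π₂(exp(−σH_{p₀}) ∘ exp(σH_p)(x,λξ)) → π₂(S₊(x,ξ))` as `λ → ∞`. -/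
theorem stmt_13 {n : ℕ} (a : Fin n → Fin n → En n → ℝ) (V : En n → ℝ) (μ : ℝ)
    (hA : AssumptionA n a V μ)
    -- a global Hamilton flow for k:
    (Yk Hk : En n → En n → ℝ → En n)
    (hKflow : ∀ x ξ : En n, IsFlowK a (Yk x ξ) (Hk x ξ) ∧ Yk x ξ 0 = x ∧ Hk x ξ 0 = ξ)
    -- a global Hamilton flow for p:
    (Yp Hp : En n → En n → ℝ → En n)
    (hPflow : ∀ x ξ : En n, IsFlowP a V (Yp x ξ) (Hp x ξ) ∧ Yp x ξ 0 = x ∧ Hp x ξ 0 = ξ)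
    -- (x₀,ξ₀) forward nontrapping:
    (x₀ ξ₀ : En n)
    (hnt : Filter.Tendsto (fun t => ‖Yk x₀ ξ₀ t‖) Filter.atTop Filter.atTop)
    (σ : ℝ) (hσ0 : 0 < σ) (hσπ : σ < π) :
    ∃ Ω : Set (En n × En n), IsOpen Ω ∧ (x₀, ξ₀) ∈ Ω ∧
      ∃ Sp : En n × En n → En n × En n,
        (∀ q ∈ Ω, Filter.Tendsto
            (fun t : ℝ => (Yk q.1 q.2 t - t • Hk q.1 q.2 t, Hk q.1 q.2 t))
            Filter.atTop (nhds (Sp q))) ∧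
        TendstoUniformlyOn
          (fun (lam : ℝ) (q : En n × En n) =>
            (Real.cos σ • Yp q.1 (lam • q.2) σ - Real.sin σ • Hp q.1 (lam • q.2) σ,
             lam⁻¹ • (Real.sin σ • Yp q.1 (lam • q.2) σ + Real.cos σ • Hp q.1 (lam • q.2) σ)))
          Sp Filter.atTop Ω := by
  obtain ⟨C, hC⟩ := HarmonicScattering.exists_shortRange hA
  obtain ⟨hflow₀, hy₀, hη₀⟩ := hKflow x₀ ξ₀
  obtain ⟨r, hr, hex, hconv⟩ := hC.exists_wave_map
    (HarmonicScattering.isCurve_of_isFlowK hflow₀)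
    (HarmonicScattering.kinetic_pos_of_tendsto hA hflow₀ hnt)
    (HarmonicScattering.kinetic_conserved hA hflow₀) hnt hσ0 hσπ
  rw [hy₀, hη₀] at hex hconv
  have hball : ∀ q ∈ Metric.ball (x₀, ξ₀) r, ‖(q.1, q.2) - (x₀, ξ₀)‖ ≤ r := fun q hq => by
    rw [← dist_eq_norm]; exact (Metric.mem_ball.1 hq).le
  have hexq : ∀ q : En n × En n, ∃ w, q ∈ Metric.ball (x₀, ξ₀) r → Tendsto
      (fun t => HarmonicScattering.back 0 t (Yk q.1 q.2 t, Hk q.1 q.2 t)) atTop (𝓝 w) := by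
    intro q
    by_cases hq : q ∈ Metric.ball (x₀, ξ₀) r
    · obtain ⟨hf, h1, h2⟩ := hKflow q.1 q.2
      obtain ⟨w, hw⟩ := hex _ _ (HarmonicScattering.isCurve_of_isFlowK hf)
        (by rw [h1, h2]; exact hball q hq)
      exact ⟨w, fun _ => hw⟩
    · exact ⟨0, fun h => absurd h hq⟩
  choose Sp hSp using hexq
  refine ⟨Metric.ball (x₀, ξ₀) r, Metric.isOpen_ball, Metric.mem_ball_self hr, Sp,
    fun q hq => ?_, Metric.tendstoUniformlyOn_iff.2 fun δ hδ => ?_⟩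
  · simpa only [HarmonicScattering.back_zero] using hSp q hq
  · obtain ⟨ε₁, hε₁, hlim⟩ := hconv δ hδ
    filter_upwards [eventually_gt_atTop 0, eventually_ge_atTop ε₁⁻¹] with lam hlam hlam₁ q hq
    obtain ⟨hf, h1, h2⟩ := hKflow q.1 q.2
    obtain ⟨hfP, h1', h2'⟩ := hPflow q.1 (lam • q.2)
    have hinit : (Yp q.1 (lam • q.2) (lam⁻¹ * 0), lam⁻¹ • Hp q.1 (lam • q.2) (lam⁻¹ * 0)) =
        (q.1, q.2) := by
      rw [mul_zero, h1', h2', inv_smul_smul₀ hlam.ne']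
    have key := hlim lam⁻¹ _ _ _ _ (Sp q) (inv_pos.2 hlam) (inv_le_of_inv_le₀ hε₁ hlam₁)
      (HarmonicScattering.isCurve_of_isFlowP hfP lam)
      (HarmonicScattering.isCurve_of_isFlowK hf) (by rw [h1, h2]; exact hinit)
      (by rw [hinit]; exact hball q hq) (hSp q hq)
    have hσ : lam⁻¹ * (σ / lam⁻¹) = σ := by field_simp
    have hsine : lam⁻¹ * HarmonicScattering.sine lam⁻¹ (σ / lam⁻¹) = sin σ := by
      rw [HarmonicScattering.mul_sine, hσ]
    have hsine' : HarmonicScattering.sine lam⁻¹ (σ / lam⁻¹) = lam * sin σ := by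
      rw [← hsine, mul_inv_cancel_left₀ hlam.ne']
    rw [dist_comm, dist_eq_norm]
    refine lt_of_eq_of_lt (congrArg (fun w => ‖w - Sp q‖) ?_) key
    simp only [HarmonicScattering.back, hσ, hsine', smul_smul, smul_add]
    refine Prod.ext ?_ ?_ <;> dsimp only <;> match_scalars <;> field_simp
end
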